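/- arXiv:math/9804082 — 10 statements merged into one kernel-verified Lean document; each statement's English description precedes it below -/
import Mathlib

section
/- Let f, g, h : ℝ → ℝ be three-times differentiable, nonconstant functions satisfying det [[1,1,1],[f(x),g(y),h(z)],[f'(x),g'(y),h'(z)]] = 0 for all real x, y, z with x + y + z = 0. Then there exist real constants p₀, p₁, p₂, p₃ such that each of the three functions w ∈ {f, g, h} satisfies the same differential equation w'(x)² = p₃ w(x)³ + p₂ w(x)² + p₁ w(x) + p₀ for all real x. -/
open Polynomial

/-- The expanded form of the determinantal functional equation. -/
def CollinearEq (f g h : ℝ → ℝ) : Prop :=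
  ∀ x y z : ℝ, x + y + z = 0 →
    deriv f x * (h z - g y) + deriv g y * (f x - h z) + deriv h z * (g y - f x) = 0

namespace CollinearEq

variable {f g h : ℝ → ℝ}

lemma swap_left (E : CollinearEq f g h) : CollinearEq g f h := by
  intro x y z hs
  linarith [E y x z (by linarith)]

lemma rotate (E : CollinearEq f g h) : CollinearEq h f g := by
  intro x y z hs
  linarith [E y z x (by linarith)]

/-- If `f` equals `c` near `x₀`, then on each line `x₀ + y + z = 0` one of `g y`, `h z` equals `c`,
for otherwise `f`, `g`, `h` would be exponentials shifted by `c`. -/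
lemma eq_or_eq_of_eventually_const (E : CollinearEq f g h)
    (hf : Differentiable ℝ f) (hg : Differentiable ℝ g) (hh : Differentiable ℝ h)
    (hfnc : ¬ ∃ c : ℝ, ∀ x, f x = c) (hgnc : ¬ ∃ c : ℝ, ∀ x, g x = c) {x₀ c ε : ℝ}
    (hε : 0 < ε) (hc : ∀ x, |x - x₀| < ε → f x = c) (y : ℝ) :
    g y = c ∨ h (-x₀ - y) = c := by
  by_contra! hne
  obtain ⟨hgy, hhy⟩ := hne
  have hf0 : ∀ x, |x - x₀| < ε → deriv f x = 0 := by
    intro x hx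
    have hev : f =ᶠ[nhds x] fun _ => c := by
      have : ∀ᶠ x' in nhds x, |x' - x₀| < ε :=
        (by fun_prop : Continuous fun x' : ℝ => |x' - x₀|).continuousAt.eventually_lt
          continuousAt_const hx
      filter_upwards [this] with x' hx' using hc x' hx'
    rw [hev.deriv_eq]; simp
  have hprod : ∀ x, |x - x₀| < ε → ∀ s t,
      (g s - c) * (h (-x - s) - c) = (g t - c) * (h (-x - t) - c) := by
    intro x hx
    have hd : ∀ s, HasDerivAt (fun s => (g s - c) * (h (-x - s) - c)) 0 s := by
      intro s
      have h1 := (hg s).hasDerivAt.sub_const c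
      have h2 := ((hh (-x - s)).hasDerivAt.comp_const_sub (-x) s).sub_const c
      refine (h1.mul h2).congr_deriv ?_
      have := E x s (-x - s) (by ring)
      rw [hf0 x hx, hc x hx] at this
      linarith
    exact fun s t => is_const_of_deriv_eq_zero (fun s => (hd s).differentiableAt)
      (fun s => (hd s).deriv) s t
  obtain ⟨δ, hδ, hδ'⟩ : ∃ δ > 0, ∀ x, |x - x₀| < δ → h (-x - y) ≠ c := by
    have hcont : ContinuousAt (fun x => h (-x - y)) x₀ :=
      (hh.continuous.comp (by fun_prop : Continuous fun x : ℝ => -x - y)).continuousAt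
    obtain ⟨δ, hδ, H⟩ := Metric.eventually_nhds_iff.1 (hcont.eventually_ne hhy)
    exact ⟨δ, hδ, fun x hx => H (by rwa [Real.dist_eq])⟩
  set η := min ε δ with hη
  have hηpos : 0 < η := lt_min hε hδ
  have hne : ∀ x, |x - x₀| < η → ∀ s, g s - c ≠ 0 ∧ h (-x - s) - c ≠ 0 := by
    intro x hx s
    have h0 : (g y - c) * (h (-x - y) - c) ≠ 0 :=
      mul_ne_zero (sub_ne_zero.2 hgy)
        (sub_ne_zero.2 (hδ' x (hx.trans_le (min_le_right _ _))))
    rw [hprod x (hx.trans_le (min_le_left _ _)) y s] at h0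
    exact mul_ne_zero_iff.1 h0
  have hg0 : ∀ s, g s - c ≠ 0 := fun s => (hne x₀ (by simpa using hηpos) s).1
  have hh0 : ∀ s, h s - c ≠ 0 := fun s => by
    simpa using (hne x₀ (by simpa using hηpos) (-x₀ - s)).2
  have hlog : ∀ x, |x - x₀| < η → ∀ s,
      deriv g s / (g s - c) = deriv h (-x - s) / (h (-x - s) - c) := by
    intro x hx s
    have := E x s (-x - s) (by ring)
    have hx' := hx.trans_le (min_le_left ε δ)
    rw [hf0 x hx', hc x hx'] at this
    rw [div_eq_div_iff (hg0 _) (hh0 _)]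
    linarith
  have hloc : IsLocallyConstant fun s => deriv g s / (g s - c) := by
    rw [IsLocallyConstant.iff_eventually_eq]
    intro s
    rw [Metric.eventually_nhds_iff]
    refine ⟨η, hηpos, fun t ht => ?_⟩
    rw [Real.dist_eq] at ht
    have h1 := hlog (x₀ + s - t) (by rw [abs_sub_comm] at ht; convert ht using 2; ring) t
    have h2 := hlog x₀ (by simpa using hηpos) s
    rw [show -(x₀ + s - t) - t = -x₀ - s by ring] at h1
    exact h1.trans h2.symm
  obtain ⟨k, hk⟩ : ∃ k, ∀ s, deriv g s / (g s - c) = k :=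
    ⟨_, fun s => hloc.apply_eq_of_isPreconnected isPreconnected_univ trivial
      (Set.mem_univ (0 : ℝ))⟩
  have hgk : ∀ s, deriv g s = k * (g s - c) := fun s => by
    rw [← hk s, div_mul_cancel₀ _ (hg0 s)]
  have hhk : ∀ s, deriv h s = k * (h s - c) := fun s => by
    have := hlog x₀ (by simpa using hηpos) (-x₀ - s)
    rw [hk, sub_sub_cancel] at this
    rw [this, div_mul_cancel₀ _ (hh0 s)]
  have hk0 : k ≠ 0 := by
    rintro rfl
    exact hgnc ⟨g 0, fun x => is_const_of_deriv_eq_zero hg (fun s => by simp [hgk]) x 0⟩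
  have hfk : ∀ x, deriv f x = k * (f x - c) := by
    intro x
    obtain ⟨s, hs⟩ : ∃ s, h (-x - s) ≠ g s := by
      by_contra! hall
      have h1 := (hh (-x - 0)).hasDerivAt.comp_const_sub (-x) 0
      have h2 : (fun s => h (-x - s)) = g := funext hall
      rw [h2] at h1
      have h3 := h1.deriv
      rw [hgk, hhk, hall] at h3
      have : k * (g 0 - c) = 0 := by linarith
      exact mul_ne_zero hk0 (hg0 0) this
    have := E x s (-x - s) (by ring)
    rw [hgk, hhk] at this
    have h4 : (deriv f x - k * (f x - c)) * (h (-x - s) - g s) = 0 := by linarith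
    have := (mul_eq_zero.1 h4).resolve_right (sub_ne_zero.2 hs)
    linarith
  have hexp : ∀ x, HasDerivAt (fun x => Real.exp (-k * x) * (f x - c)) 0 x := by
    intro x
    have h1 := (((hasDerivAt_id x).const_mul (-k)).exp).mul ((hf x).hasDerivAt.sub_const c)
    refine h1.congr_deriv ?_
    rw [hfk]; simp; ring
  refine hfnc ⟨c, fun x => ?_⟩
  have h1 := is_const_of_deriv_eq_zero (fun s => (hexp s).differentiableAt)
      (fun s => (hexp s).deriv) x x₀
  simp only [hc x₀ (by simpa using hε), sub_self, mul_zero] at h1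
  exact sub_eq_zero.1 ((mul_eq_zero.1 h1).resolve_left (Real.exp_ne_zero _))

lemma exists_ne (E : CollinearEq f g h)
    (hf : Differentiable ℝ f) (hg : Differentiable ℝ g) (hh : Differentiable ℝ h)
    (hfnc : ¬ ∃ c : ℝ, ∀ x, f x = c) (hgnc : ¬ ∃ c : ℝ, ∀ x, g x = c)
    (hhnc : ¬ ∃ c : ℝ, ∀ x, h x = c) (x₀ c : ℝ) {ε : ℝ} (hε : 0 < ε) :
    ∃ x, |x - x₀| < ε ∧ f x ≠ c := by
  by_contra! hc
  obtain ⟨y₀, hy₀⟩ : ∃ y, g y ≠ c := by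
    by_contra! H
    exact hgnc ⟨c, H⟩
  obtain ⟨δ, hδ, hgδ⟩ := Metric.eventually_nhds_iff.1
    (hg.continuous.continuousAt.eventually_ne hy₀)
  have step : ∀ x₁ r, 0 < r → (∀ x, |x - x₁| < r → f x = c) →
      ∀ t, |t| < δ → f (x₁ + t) = c := by
    intro x₁ r hr hx t ht
    have hz : ∀ z, |z - (-x₁ - (y₀ + t))| < r → h z = c := by
      intro z hz
      have h1 := E.eq_or_eq_of_eventually_const hf hg hh hfnc hgnc
        (x₀ := -z - (y₀ + t)) (c := c) (ε := r - |-z - (y₀ + t) - x₁|) (by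
          rw [sub_pos, abs_sub_comm]; convert hz using 2; ring)
        (fun x hx' => hx x (by
          have := abs_sub_le x (-z - (y₀ + t)) x₁
          linarith)) (y₀ + t)
      rcases h1 with h1 | h1
      · exact absurd h1 (hgδ (by simpa [Real.dist_eq] using ht))
      · convert h1 using 2; ring
    have h2 := E.rotate.eq_or_eq_of_eventually_const hh hf hg hhnc hfnc hr hz (x₁ + t)
    rcases h2 with h2 | h2
    · exact h2
    · refine absurd h2 ?_
      rwa [show -(-x₁ - (y₀ + t)) - (x₁ + t) = y₀ by ring]
  have hclopen : IsClopen {x | ∀ᶠ x' in nhds x, f x' = c} := by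
    refine ⟨?_, ?_⟩
    · refine isClosed_of_closure_subset fun x hx => ?_
      obtain ⟨i, hi, hxi⟩ := Metric.mem_closure_iff.1 hx δ hδ
      obtain ⟨r, hr, hir⟩ := Metric.eventually_nhds_iff.1 hi
      have hcont : ContinuousAt (fun x' : ℝ => |x' - i|) x := by fun_prop
      have hlt : ∀ᶠ x' in nhds x, |x' - i| < δ := hcont.eventually_lt continuousAt_const hxi
      filter_upwards [hlt] with x' hx'
      simpa using step i r hr (fun x hx => hir hx) (x' - i) hx'
    · exact isOpen_iff_mem_nhds.2 fun x hx => eventually_eventually_nhds.2 hx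
  have huniv := hclopen.eq_univ ⟨x₀, Metric.eventually_nhds_iff.2 ⟨ε, hε, fun x hx => hc x hx⟩⟩
  refine hfnc ⟨c, fun x => ?_⟩
  have hx : ∀ᶠ x' in nhds x, f x' = c := Set.eq_univ_iff_forall.1 huniv x
  exact hx.self_of_nhds

lemma deriv_deriv_relation (E : CollinearEq f g h)
    (hf1 : Differentiable ℝ f) (hf2 : Differentiable ℝ (deriv f))
    (hg1 : Differentiable ℝ g) (hg2 : Differentiable ℝ (deriv g))
    {x y z : ℝ} (hs : x + y + z = 0) :
    deriv (deriv f) x * (h z - g y) - deriv (deriv g) y * (f x - h z)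
      + 2 * deriv f x * deriv g y - deriv h z * (deriv f x + deriv g y) = 0 := by
  obtain rfl : y = -z - x := by linarith
  have F := (hf1 x).hasDerivAt
  have F' := (hf2 x).hasDerivAt
  have G := (hg1 (-z - x)).hasDerivAt.comp_const_sub (-z) x
  have G' := (hg2 (-z - x)).hasDerivAt.comp_const_sub (-z) x
  have key := ((F'.mul (G.const_sub (h z))).add (G'.mul (F.sub_const (h z)))).add
    ((G.sub F).const_mul (deriv h z))
  have hzero : HasDerivAt (fun _ : ℝ => (0 : ℝ)) 0 x := hasDerivAt_const x 0
  have h1 := key.unique (hzero.congr_of_eventuallyEq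
    (Filter.Eventually.of_forall fun t => E t (-z - t) z (by ring)))
  linarith

end CollinearEq

/-- The slope of the chord joining the point of the curve (f, deriv f) over x to that of (g, deriv g) over y. -/
noncomputable def chordSlope (f g : ℝ → ℝ) (x y : ℝ) : ℝ :=
  (deriv f x - deriv g y) / (f x - g y)

/-- Half of the leading coefficient of the cubic attached to the points over `x`, `y` and
`-x - y`. -/
noncomputable def halfLead (f g h : ℝ → ℝ) (x y : ℝ) : ℝ :=
  (deriv (deriv f) x - chordSlope f g x y * deriv f x) /
    ((f x - g y) * (f x - h (-x - y)))

/-- The cubic `p` for which `v ^ 2 = p u` meets the line through the three collinear points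
exactly in these points. -/
noncomputable def chordCubic (f g h : ℝ → ℝ) (x y : ℝ) : ℝ[X] :=
  (C (chordSlope f g x y) * (X - C (f x)) + C (deriv f x)) ^ 2 +
    C (2 * halfLead f g h x y) * ((X - C (f x)) * (X - C (g y)) * (X - C (h (-x - y))))

/-- Pairs `(x, y)` for which `f x`, `g y`, `h (-x - y)` are pairwise distinct. -/
def distinctLocus (f g h : ℝ → ℝ) : Set (ℝ × ℝ) :=
  {p | f p.1 ≠ g p.2 ∧ g p.2 ≠ h (-p.1 - p.2) ∧ f p.1 ≠ h (-p.1 - p.2)}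

lemma natDegree_chordCubic_lt (f g h : ℝ → ℝ) (x y : ℝ) :
    (chordCubic f g h x y).natDegree < 4 := by
  rw [Nat.lt_succ_iff]
  unfold chordCubic
  compute_degree

lemma eval_chordCubic (f g h : ℝ → ℝ) (x y u : ℝ) :
    (chordCubic f g h x y).eval u =
      (chordSlope f g x y * (u - f x) + deriv f x) ^ 2 +
        2 * halfLead f g h x y * ((u - f x) * (u - g y) * (u - h (-x - y))) := by
  simp [chordCubic]

lemma eval_chordCubic_first (f g h : ℝ → ℝ) (x y : ℝ) :
    (chordCubic f g h x y).eval (f x) = deriv f x ^ 2 := by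
  simp [eval_chordCubic]

lemma swap_mem_distinctLocus {f g h : ℝ → ℝ} {x y : ℝ} (hp : (x, y) ∈ distinctLocus f g h) :
    (y, x) ∈ distinctLocus g f h := by
  obtain ⟨h1, h2, h3⟩ := hp
  have e : -y - x = -x - y := by ring
  exact ⟨h1.symm, by simpa [e] using h3, by simpa [e] using h2⟩

namespace CollinearEq

variable {f g h : ℝ → ℝ}

lemma chordSlope_mul_left {x y : ℝ} (hp : (x, y) ∈ distinctLocus f g h) :
    chordSlope f g x y * (f x - g y) = deriv f x - deriv g y :=
  div_mul_cancel₀ _ (sub_ne_zero.2 hp.1)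

lemma chordSlope_mul_right (E : CollinearEq f g h) {x y : ℝ}
    (hp : (x, y) ∈ distinctLocus f g h) :
    chordSlope f g x y * (f x - h (-x - y)) = deriv f x - deriv h (-x - y) := by
  have h1 := E x y (-x - y) (by ring)
  rw [chordSlope, div_mul_eq_mul_div, div_eq_iff (sub_ne_zero.2 hp.1)]
  linarith

lemma eval_chordCubic_third (E : CollinearEq f g h) {x y : ℝ}
    (hp : (x, y) ∈ distinctLocus f g h) :
    (chordCubic f g h x y).eval (h (-x - y)) = deriv h (-x - y) ^ 2 := by
  have h1 := E.chordSlope_mul_right hp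
  rw [eval_chordCubic, sub_self, mul_zero, mul_zero, add_zero]
  congr 1
  linarith

lemma halfLead_mul {x y : ℝ} (hp : (x, y) ∈ distinctLocus f g h) :
    halfLead f g h x y * ((f x - g y) * (f x - h (-x - y))) =
      deriv (deriv f) x - chordSlope f g x y * deriv f x :=
  div_mul_cancel₀ _ (mul_ne_zero (sub_ne_zero.2 hp.1) (sub_ne_zero.2 hp.2.2))

lemma chordSlope_swap (f g : ℝ → ℝ) (x y : ℝ) : chordSlope g f y x = chordSlope f g x y := by
  rw [chordSlope, chordSlope, ← neg_sub (deriv f x), ← neg_sub (f x), neg_div_neg_eq]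

lemma halfLead_swap (E : CollinearEq f g h)
    (hf1 : Differentiable ℝ f) (hf2 : Differentiable ℝ (deriv f))
    (hg1 : Differentiable ℝ g) (hg2 : Differentiable ℝ (deriv g)) {x y : ℝ}
    (hp : (x, y) ∈ distinctLocus f g h) :
    halfLead g f h y x = halfLead f g h x y := by
  have e : -y - x = -x - y := by ring
  have h1 := E.deriv_deriv_relation hf1 hf2 hg1 hg2 (show x + y + (-x - y) = 0 by ring)
  have h2 := chordSlope_mul_left hp
  have h3 := E.chordSlope_mul_right hp
  have h4 := halfLead_mul hp
  have h5 := halfLead_mul (swap_mem_distinctLocus hp)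
  rw [chordSlope_swap, e] at h5
  have n1 := sub_ne_zero.2 hp.1
  have n2 := sub_ne_zero.2 hp.2.1
  have n3 := sub_ne_zero.2 hp.2.2
  simp only at n1 n2 n3
  refine mul_left_cancel₀ (mul_ne_zero (mul_ne_zero n1 n2) n3) ?_
  generalize chordSlope f g x y = m at *
  linear_combination (-(f x - h (-x - y))) * h5 - (g y - h (-x - y)) * h4 + h1
    + deriv f x * (h3 - h2) + deriv g y * h3

lemma chordCubic_swap (E : CollinearEq f g h)
    (hf1 : Differentiable ℝ f) (hf2 : Differentiable ℝ (deriv f))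
    (hg1 : Differentiable ℝ g) (hg2 : Differentiable ℝ (deriv g)) {x y : ℝ}
    (hp : (x, y) ∈ distinctLocus f g h) :
    chordCubic g f h y x = chordCubic f g h x y := by
  refine Polynomial.funext fun u => ?_
  have e : -y - x = -x - y := by ring
  have h2 := chordSlope_mul_left hp
  rw [eval_chordCubic, eval_chordCubic, E.halfLead_swap hf1 hf2 hg1 hg2 hp, chordSlope_swap, e]
  have : chordSlope f g x y * (u - g y) + deriv g y =
      chordSlope f g x y * (u - f x) + deriv f x := by linarith
  rw [this]; ring

lemma hasDerivAt_chordSlope (E : CollinearEq f g h)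
    (hf1 : Differentiable ℝ f) (hf2 : Differentiable ℝ (deriv f))
    (hg1 : Differentiable ℝ g) (hg2 : Differentiable ℝ (deriv g)) {x y : ℝ}
    (hp : (x, y) ∈ distinctLocus f g h) :
    HasDerivAt (fun y => chordSlope f g x y) (halfLead f g h x y * (g y - h (-x - y))) y := by
  have e : -y - x = -x - y := by ring
  have n1 : f x - g y ≠ 0 := sub_ne_zero.2 hp.1
  have key := ((hg2 y).hasDerivAt.const_sub (deriv f x)).div
    ((hg1 y).hasDerivAt.const_sub (f x)) n1
  refine key.congr_deriv ?_
  rw [div_eq_iff (pow_ne_zero 2 n1)]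
  have h2 := chordSlope_mul_left hp
  have h5 := halfLead_mul (swap_mem_distinctLocus hp)
  rw [chordSlope_swap, e, E.halfLead_swap hf1 hf2 hg1 hg2 hp] at h5
  linear_combination (f x - g y) * h5 - deriv g y * h2

lemma hasDerivAt_halfLead (E : CollinearEq f g h)
    (hf1 : Differentiable ℝ f) (hf2 : Differentiable ℝ (deriv f))
    (hg1 : Differentiable ℝ g) (hg2 : Differentiable ℝ (deriv g))
    (hh1 : Differentiable ℝ h) {x y : ℝ} (hp : (x, y) ∈ distinctLocus f g h) :
    HasDerivAt (fun y => halfLead f g h x y) 0 y := by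
  have n1 : f x - g y ≠ 0 := sub_ne_zero.2 hp.1
  have n3 : f x - h (-x - y) ≠ 0 := sub_ne_zero.2 hp.2.2
  have H := (hh1 (-x - y)).hasDerivAt.comp_const_sub (-x) y
  have key := (((E.hasDerivAt_chordSlope hf1 hf2 hg1 hg2 hp).mul_const
    (deriv f x)).const_sub (deriv (deriv f) x)).div
    (((hg1 y).hasDerivAt.const_sub (f x)).mul (H.const_sub (f x))) (mul_ne_zero n1 n3)
  refine key.congr_deriv ?_
  simp only [Pi.mul_apply]
  rw [div_eq_iff (pow_ne_zero 2 (mul_ne_zero n1 n3)), zero_mul, ← halfLead_mul hp]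
  have h1 := E x y (-x - y) (by ring)
  linear_combination (halfLead f g h x y * (f x - g y) * (f x - h (-x - y))) * h1

lemma hasDerivAt_eval_chordCubic (E : CollinearEq f g h)
    (hf1 : Differentiable ℝ f) (hf2 : Differentiable ℝ (deriv f))
    (hg1 : Differentiable ℝ g) (hg2 : Differentiable ℝ (deriv g))
    (hh1 : Differentiable ℝ h) {x y : ℝ} (hp : (x, y) ∈ distinctLocus f g h) (u : ℝ) :
    HasDerivAt (fun y => (chordCubic f g h x y).eval u) 0 y := by
  simp only [eval_chordCubic]
  have H := (hh1 (-x - y)).hasDerivAt.comp_const_sub (-x) y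
  have M := E.hasDerivAt_chordSlope hf1 hf2 hg1 hg2 hp
  have L := E.hasDerivAt_halfLead hf1 hf2 hg1 hg2 hh1 hp
  have key := (((M.mul_const (u - f x)).add_const (deriv f x)).pow 2).add
    ((L.const_mul 2).mul ((((hg1 y).hasDerivAt.const_sub u).const_mul (u - f x)).mul
      (H.const_sub u)))
  refine key.congr_deriv ?_
  have h2 := chordSlope_mul_left hp
  have h3 := E.chordSlope_mul_right hp
  simp
  linear_combination (-2 * halfLead f g h x y * (u - f x)) *
    ((u - h (-x - y)) * h2 - (u - g y) * h3)

lemma isOpen_distinctLocus (hf : Continuous f) (hg : Continuous g) (hh : Continuous h) :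
    IsOpen (distinctLocus f g h) := by
  refine (isOpen_ne_fun (by fun_prop) (by fun_prop)).inter
    ((isOpen_ne_fun (by fun_prop) (by fun_prop)).inter
      (isOpen_ne_fun (by fun_prop) (by fun_prop)))

lemma chordCubic_eq_of_ball (E : CollinearEq f g h)
    (hf1 : Differentiable ℝ f) (hf2 : Differentiable ℝ (deriv f))
    (hg1 : Differentiable ℝ g) (hg2 : Differentiable ℝ (deriv g))
    (hh1 : Differentiable ℝ h) {x y₀ ε : ℝ}
    (hb : ∀ y ∈ Metric.ball y₀ ε, (x, y) ∈ distinctLocus f g h) {y y' : ℝ}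
    (hy : y ∈ Metric.ball y₀ ε) (hy' : y' ∈ Metric.ball y₀ ε) :
    chordCubic f g h x y = chordCubic f g h x y' := by
  refine Polynomial.funext fun u => ?_
  have hd := fun t ht => E.hasDerivAt_eval_chordCubic hf1 hf2 hg1 hg2 hh1 (hb t ht) u
  exact Metric.isOpen_ball.is_const_of_deriv_eq_zero (convex_ball y₀ ε).isPreconnected
    (fun t ht => (hd t ht).differentiableAt.differentiableWithinAt)
    (fun t ht => (hd t ht).deriv) hy hy'

lemma chordCubic_locally_const (E : CollinearEq f g h)
    (hf1 : Differentiable ℝ f) (hf2 : Differentiable ℝ (deriv f))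
    (hg1 : Differentiable ℝ g) (hg2 : Differentiable ℝ (deriv g))
    (hh1 : Differentiable ℝ h) {x₀ y₀ : ℝ} (hp : (x₀, y₀) ∈ distinctLocus f g h) :
    ∃ ε > 0, ∀ x ∈ Metric.ball x₀ ε, ∀ y ∈ Metric.ball y₀ ε,
      (x, y) ∈ distinctLocus f g h ∧ chordCubic f g h x y = chordCubic f g h x₀ y₀ := by
  obtain ⟨ε, hε, hsub⟩ := Metric.isOpen_iff.1
    (isOpen_distinctLocus hf1.continuous hg1.continuous hh1.continuous) _ hp
  have hbox : ∀ x ∈ Metric.ball x₀ ε, ∀ y ∈ Metric.ball y₀ ε, (x, y) ∈ distinctLocus f g h :=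
    fun x hx y hy => hsub (by rw [← ball_prod_same]; exact ⟨hx, hy⟩)
  have hy₀ := Metric.mem_ball_self (x := y₀) hε
  have hx₀ := Metric.mem_ball_self (x := x₀) hε
  refine ⟨ε, hε, fun x hx y hy => ⟨hbox x hx y hy, ?_⟩⟩
  rw [E.chordCubic_eq_of_ball hf1 hf2 hg1 hg2 hh1 (hbox x hx) hy hy₀,
    ← E.chordCubic_swap hf1 hf2 hg1 hg2 (hbox x hx y₀ hy₀),
    ← E.chordCubic_swap hf1 hf2 hg1 hg2 (hbox x₀ hx₀ y₀ hy₀)]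
  exact E.swap_left.chordCubic_eq_of_ball hg1 hg2 hf1 hf2 hh1
    (fun t ht => swap_mem_distinctLocus (hbox t ht y₀ hy₀)) hx hx₀

lemma chordCubic_eq_of_same_left (E : CollinearEq f g h)
    (hf1 : Differentiable ℝ f) (hf2 : Differentiable ℝ (deriv f))
    (hg1 : Differentiable ℝ g) (hg2 : Differentiable ℝ (deriv g))
    (hh1 : Differentiable ℝ h)
    (hfne : ∀ x₀ c ε : ℝ, 0 < ε → ∃ x, |x - x₀| < ε ∧ f x ≠ c) {x y y' : ℝ}
    (hp : (x, y) ∈ distinctLocus f g h) (hp' : (x, y') ∈ distinctLocus f g h) :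
    chordCubic f g h x y = chordCubic f g h x y' := by
  obtain ⟨ε, hε, H⟩ := E.chordCubic_locally_const hf1 hf2 hg1 hg2 hh1 hp
  obtain ⟨ε', hε', H'⟩ := E.chordCubic_locally_const hf1 hf2 hg1 hg2 hh1 hp'
  have hpos : 0 < min ε ε' := lt_min hε hε'
  have hinf : (f '' Metric.ball x (min ε ε')).Infinite := by
    refine ((convex_ball x _).isPreconnected.image f
      hf1.continuous.continuousOn).infinite_of_nontrivial ?_
    obtain ⟨x', hx', hne⟩ := hfne x (f x) _ hpos
    exact ⟨f x', ⟨x', hx', rfl⟩, f x, ⟨x, Metric.mem_ball_self hpos, rfl⟩, hne⟩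
  refine Polynomial.eq_of_infinite_eval_eq _ _ (hinf.mono ?_)
  rintro _ ⟨t, ht, rfl⟩
  have h1 := (H t (Metric.ball_subset_ball (min_le_left _ _) ht) y
    (Metric.mem_ball_self hε)).2
  have h2 := (H' t (Metric.ball_subset_ball (min_le_right _ _) ht) y'
    (Metric.mem_ball_self hε')).2
  rw [Set.mem_ofPred_eq, ← h1, ← h2, eval_chordCubic_first, eval_chordCubic_first]

lemma dense_distinctLocus (hf : Continuous f) (hg : Continuous g) (hh : Continuous h)
    (hfne : ∀ x₀ c ε : ℝ, 0 < ε → ∃ x, |x - x₀| < ε ∧ f x ≠ c)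
    (hhne : ∀ x₀ c ε : ℝ, 0 < ε → ∃ x, |x - x₀| < ε ∧ h x ≠ c) :
    Dense (distinctLocus f g h) := by
  have d1 : Dense {p : ℝ × ℝ | f p.1 ≠ g p.2} := by
    rintro ⟨x, y⟩
    refine Metric.mem_closure_iff.2 fun ε hε => ?_
    obtain ⟨x', hx', hne⟩ := hfne x (g y) ε hε
    exact ⟨(x', y), hne, by simpa [Prod.dist_eq, Real.dist_eq, abs_sub_comm, hε] using hx'⟩
  have d2 : Dense {p : ℝ × ℝ | g p.2 ≠ h (-p.1 - p.2)} := by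
    rintro ⟨x, y⟩
    refine Metric.mem_closure_iff.2 fun ε hε => ?_
    obtain ⟨z, hz, hne⟩ := hhne (-x - y) (g y) ε hε
    refine ⟨(-z - y, y), by simpa using hne.symm, ?_⟩
    simp only [Prod.dist_eq, Real.dist_eq, sub_self, abs_zero, max_lt_iff, hε, and_true]
    rwa [show x - (-z - y) = z - (-x - y) by ring]
  have d3 : Dense {p : ℝ × ℝ | f p.1 ≠ h (-p.1 - p.2)} := by
    rintro ⟨x, y⟩
    refine Metric.mem_closure_iff.2 fun ε hε => ?_
    obtain ⟨z, hz, hne⟩ := hhne (-x - y) (f x) ε hε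
    refine ⟨(x, -x - z), by simpa using hne.symm, ?_⟩
    simp only [Prod.dist_eq, Real.dist_eq, sub_self, abs_zero, max_lt_iff, hε, true_and]
    rwa [show y - (-x - z) = z - (-x - y) by ring]
  refine d1.inter_of_isOpen_left (d2.inter_of_isOpen_left d3 ?_) ?_
  · exact isOpen_ne_fun (by fun_prop) (by fun_prop)
  · exact isOpen_ne_fun (by fun_prop) (by fun_prop)

lemma chordCubic_const (E : CollinearEq f g h)
    (hf1 : Differentiable ℝ f) (hf2 : Differentiable ℝ (deriv f))
    (hg1 : Differentiable ℝ g) (hg2 : Differentiable ℝ (deriv g))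
    (hh1 : Differentiable ℝ h)
    (hfne : ∀ x₀ c ε : ℝ, 0 < ε → ∃ x, |x - x₀| < ε ∧ f x ≠ c)
    (hgne : ∀ x₀ c ε : ℝ, 0 < ε → ∃ x, |x - x₀| < ε ∧ g x ≠ c)
    (hdense : Dense (distinctLocus f g h)) {x₁ y₁ x₂ y₂ : ℝ}
    (hp₁ : (x₁, y₁) ∈ distinctLocus f g h) (hp₂ : (x₂, y₂) ∈ distinctLocus f g h) :
    chordCubic f g h x₁ y₁ = chordCubic f g h x₂ y₂ := by
  obtain ⟨ε, hε, H⟩ := E.chordCubic_locally_const hf1 hf2 hg1 hg2 hh1 hp₁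
  obtain ⟨ε', hε', H'⟩ := E.chordCubic_locally_const hf1 hf2 hg1 hg2 hh1 hp₂
  obtain ⟨⟨x, y⟩, hp, hx, hy⟩ := hdense.exists_mem_open
    (Metric.isOpen_ball.prod Metric.isOpen_ball)
    (⟨(x₁, y₂), Metric.mem_ball_self hε, Metric.mem_ball_self hε'⟩ :
      (Metric.ball x₁ ε ×ˢ Metric.ball y₂ ε').Nonempty)
  obtain ⟨m1, e1⟩ := H x hx y₁ (Metric.mem_ball_self hε)
  obtain ⟨m2, e2⟩ := H' x₂ (Metric.mem_ball_self hε') y hy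
  rw [← e1, ← e2, E.chordCubic_eq_of_same_left hf1 hf2 hg1 hg2 hh1 hfne m1 hp,
    ← E.chordCubic_swap hf1 hf2 hg1 hg2 hp, ← E.chordCubic_swap hf1 hf2 hg1 hg2 m2]
  exact E.swap_left.chordCubic_eq_of_same_left hg1 hg2 hf1 hf2 hh1 hgne
    (swap_mem_distinctLocus hp) (swap_mem_distinctLocus m2)

end CollinearEq

theorem stmt_0 (f g h : ℝ → ℝ)
    (hf1 : Differentiable ℝ f) (hf2 : Differentiable ℝ (deriv f))
    (hf3 : Differentiable ℝ (deriv (deriv f)))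
    (hg1 : Differentiable ℝ g) (hg2 : Differentiable ℝ (deriv g))
    (hg3 : Differentiable ℝ (deriv (deriv g)))
    (hh1 : Differentiable ℝ h) (hh2 : Differentiable ℝ (deriv h))
    (hh3 : Differentiable ℝ (deriv (deriv h)))
    (hfnc : ¬ ∃ c : ℝ, ∀ x, f x = c)
    (hgnc : ¬ ∃ c : ℝ, ∀ x, g x = c)
    (hhnc : ¬ ∃ c : ℝ, ∀ x, h x = c)
    (heq : ∀ x y z : ℝ, x + y + z = 0 →
      Matrix.det !![(1 : ℝ), 1, 1; f x, g y, h z; deriv f x, deriv g y, deriv h z] = 0) :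
    ∃ p₀ p₁ p₂ p₃ : ℝ,
      (∀ x : ℝ, (deriv f x) ^ 2 = p₃ * (f x) ^ 3 + p₂ * (f x) ^ 2 + p₁ * f x + p₀) ∧
      (∀ x : ℝ, (deriv g x) ^ 2 = p₃ * (g x) ^ 3 + p₂ * (g x) ^ 2 + p₁ * g x + p₀) ∧
      (∀ x : ℝ, (deriv h x) ^ 2 = p₃ * (h x) ^ 3 + p₂ * (h x) ^ 2 + p₁ * h x + p₀) := by
  have E : CollinearEq f g h := by
    intro x y z hs
    have := heq x y z hs
    simp [Matrix.det_fin_three] at this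
    linarith
  have hfne : ∀ x₀ c ε : ℝ, 0 < ε → ∃ x, |x - x₀| < ε ∧ f x ≠ c :=
    fun x₀ c ε hε => E.exists_ne hf1 hg1 hh1 hfnc hgnc hhnc x₀ c hε
  have hgne : ∀ x₀ c ε : ℝ, 0 < ε → ∃ x, |x - x₀| < ε ∧ g x ≠ c :=
    fun x₀ c ε hε => E.swap_left.exists_ne hg1 hf1 hh1 hgnc hfnc hhnc x₀ c hε
  have hhne : ∀ x₀ c ε : ℝ, 0 < ε → ∃ x, |x - x₀| < ε ∧ h x ≠ c :=
    fun x₀ c ε hε => E.rotate.exists_ne hh1 hf1 hg1 hhnc hfnc hgnc x₀ c hε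
  have cf := hf1.continuous
  have cg := hg1.continuous
  have ch := hh1.continuous
  have cf' := hf2.continuous
  have cg' := hg2.continuous
  have ch' := hh2.continuous
  have hdense := CollinearEq.dense_distinctLocus cf cg ch hfne hhne
  obtain ⟨⟨x₀, y₀⟩, hp₀⟩ := hdense.nonempty
  set p := chordCubic f g h x₀ y₀ with hp_def
  have heval : ∀ u, p.eval u = p.coeff 3 * u ^ 3 + p.coeff 2 * u ^ 2 + p.coeff 1 * u
      + p.coeff 0 := by
    intro u
    rw [Polynomial.eval_eq_sum_range' (natDegree_chordCubic_lt f g h x₀ y₀)]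
    simp only [Finset.sum_range_succ, Finset.sum_range_zero]
    ring
  have hconst : ∀ q ∈ distinctLocus f g h, chordCubic f g h q.1 q.2 = p := fun q hq =>
    E.chordCubic_const hf1 hf2 hg1 hg2 hh1 hfne hgne hdense hq hp₀
  have cp := p.continuous
  have hF : (fun q : ℝ × ℝ => deriv f q.1 ^ 2) = fun q => p.eval (f q.1) :=
    Continuous.ext_on hdense (by fun_prop) (by fun_prop) fun q hq => by
      simp only [← hconst q hq, eval_chordCubic_first]
  have hG : (fun q : ℝ × ℝ => deriv g q.2 ^ 2) = fun q => p.eval (g q.2) :=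
    Continuous.ext_on hdense (by fun_prop) (by fun_prop) fun q hq => by
      simp only [← hconst q hq, ← E.chordCubic_swap hf1 hf2 hg1 hg2 hq, eval_chordCubic_first]
  have hH : (fun q : ℝ × ℝ => deriv h (-q.1 - q.2) ^ 2) = fun q => p.eval (h (-q.1 - q.2)) :=
    Continuous.ext_on hdense (by fun_prop) (by fun_prop) fun q hq => by
      simp only [← hconst q hq, E.eval_chordCubic_third hq]
  refine ⟨p.coeff 0, p.coeff 1, p.coeff 2, p.coeff 3, fun x => ?_, fun x => ?_, fun x => ?_⟩
  · rw [← heval]; exact congrFun hF (x, 0)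
  · rw [← heval]; exact congrFun hG (0, x)
  · rw [← heval]; simpa using congrFun hH (-x, 0)
end

section
/- Let f : ℝ → ℝ be a three-times differentiable, nonconstant function satisfying det [[1,1,1],[f(x),f(y),f(z)],[f'(x),f'(y),f'(z)]] = 0 for all real x, y, z with x + y + z = 0. Then there exist real constants p₀, p₁, p₂, p₃ such that f'(x)² = p₃ f(x)³ + p₂ f(x)² + p₁ f(x) + p₀ for all real x. -/
/-- A solution of `f' = c f` on a convex set that vanishes somewhere vanishes identically. -/
theorem eq_zero_of_deriv_eq_const_mul {f f' : ℝ → ℝ} (hf : ∀ x, HasDerivAt f (f' x) x)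
    {s : Set ℝ} (hs : Convex ℝ s) {c t : ℝ} (hode : ∀ x ∈ s, f' x = c * f x) (ht : t ∈ s)
    (hft : f t = 0) : ∀ x ∈ s, f x = 0 := by
  intro x hx
  have hd : ∀ y ∈ s, HasDerivWithinAt (fun y => f y * Real.exp (-c * y)) 0 s y := by
    intro y hy
    have he : HasDerivAt (fun y : ℝ => Real.exp (-c * y)) (Real.exp (-c * y) * (-c * 1)) y :=
      ((hasDerivAt_id y).const_mul (-c)).exp
    refine ((hf y).mul he).hasDerivWithinAt.congr_deriv ?_
    rw [hode y hy]
    ring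
  have key := hs.norm_image_sub_le_of_norm_hasDerivWithin_le hd
    (fun y _ => (norm_zero (E := ℝ)).le) ht hx
  simp only [hft, zero_mul, sub_zero, norm_le_zero_iff] at key
  exact (mul_eq_zero.mp key).resolve_right (Real.exp_pos _).ne'

theorem exists_mul_sub_pos_of_hasDerivAt {f : ℝ → ℝ} {a x : ℝ} (hf : HasDerivAt f a x)
    (ha : 0 < a) (hx : f x = 0) :
    ∃ ε > 0, ∀ y, |y - x| < ε → y ≠ x → 0 < f y * (y - x) := by
  have h := (hasDerivAt_iff_tendsto_slope.mp hf).eventually (lt_mem_nhds ha)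
  rw [eventually_nhdsWithin_iff, Metric.eventually_nhds_iff] at h
  obtain ⟨ε, hε, h⟩ := h
  refine ⟨ε, hε, fun y hy hne => ?_⟩
  have hs := h (by rwa [Real.dist_eq]) hne
  rw [slope_def_field, hx, sub_zero] at hs
  have hsq : 0 < (y - x) ^ 2 := by
    have := sub_ne_zero.mpr hne
    positivity
  have := mul_pos hs hsq
  have hne' := sub_ne_zero.mpr hne
  rwa [show f y / (y - x) * (y - x) ^ 2 = f y * (y - x) by field_simp] at this

/-- The functional equation, with the determinant expanded and `z = -x - y`. -/
def CollinearTriples (f f' : ℝ → ℝ) : Prop :=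
  ∀ x y : ℝ, (f y - f x) * (f' (-x - y) - f' x) = (f (-x - y) - f x) * (f' y - f' x)

namespace CollinearTriples

variable {f f' f'' : ℝ → ℝ}

theorem comp_neg (E : CollinearTriples f f') : 
    CollinearTriples (fun x => f (-x)) (fun x => -f' (-x)) := by
  intro x y
  have h := E (-x) (-y)
  rw [show - -x - -y = -(-x - y) by ring] at h
  linear_combination -h

theorem neg (E : CollinearTriples f f') : CollinearTriples (fun x => -f x) (fun x => -f' x) := by
  intro x y
  linear_combination E x y

theorem at_zero (E : CollinearTriples f f') (h0 : f 0 = 0) (x : ℝ) :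
    f x * (f' (-x) - f' 0) = f (-x) * (f' x - f' 0) := by
  have h := E 0 x
  rw [show -0 - x = -x by ring, h0] at h
  linear_combination h

theorem deriv_at_zero (E : CollinearTriples f f') (h0 : f 0 = 0) (h1 : ∀ x, HasDerivAt f (f' x) x)
    (h2 : ∀ x, HasDerivAt f' (f'' x) x) (x : ℝ) :
    f x * f'' (-x) = f'' 0 * (f (-x) - f x) + f' 0 * f' x - 2 * f' 0 * f' (-x)
      + f' x * f' (-x) := by
  have hl : HasDerivAt (fun z : ℝ => -x - z) (-1) 0 := by
    simpa using (hasDerivAt_id (0 : ℝ)).const_sub (-x)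
  have hx : -x - 0 = -x := by ring
  have A1 : HasDerivAt (fun z => f (-x - z)) (f' (-x) * -1) 0 :=
    HasDerivAt.comp (h := fun z : ℝ => -x - z) 0 (by rw [hx]; exact h1 (-x)) hl
  have A2 : HasDerivAt (fun z => f' (-x - z)) (f'' (-x) * -1) 0 :=
    HasDerivAt.comp (h := fun z : ℝ => -x - z) 0 (by rw [hx]; exact h2 (-x)) hl
  have L := ((h1 0).sub_const (f x)).mul (A2.sub_const (f' x))
  have R := (A1.sub_const (f x)).mul ((h2 0).sub_const (f' x))
  have heq : (fun z => f z - f x) * (fun z => f' (-x - z) - f' x)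
      = (fun z => f (-x - z) - f x) * (fun z => f' z - f' x) := by
    funext z
    exact E x z
  rw [heq] at L
  have := L.unique R
  simp only [hx, h0] at this
  linear_combination this

theorem first_integral (E : CollinearTriples f f') (h0 : f 0 = 0)
    (h1 : ∀ x, HasDerivAt f (f' x) x) (h2 : ∀ x, HasDerivAt f' (f'' x) x) {k : ℝ}
    (hk : f'' 0 = k * f' 0) (x : ℝ) :
    f' x * f (-x) + 2 * f' 0 * f x + f' 0 * f (-x) + k * (f x * f (-x)) = 0 := by
  set J : ℝ → ℝ := fun x =>
    f' x * f (-x) + 2 * f' 0 * f x + f' 0 * f (-x) + k * (f x * f (-x)) with hJ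
  have hd : ∀ x, HasDerivAt J 0 x := by
    intro x
    have hn : HasDerivAt (fun x => f (-x)) (f' (-x) * -1) x :=
      (h1 (-x)).comp x (hasDerivAt_neg x)
    have := ((((h2 x).mul hn).add ((h1 x).const_mul (2 * f' 0))).add
      (hn.const_mul (f' 0))).add (((h1 x).mul hn).const_mul k)
    refine this.congr_deriv ?_
    have e1 := E.deriv_at_zero h0 h1 h2 (-x)
    have e0 := E.at_zero h0 x
    rw [neg_neg, hk] at e1
    linear_combination e1 - k * e0
  have := is_const_of_deriv_eq_zero (fun x => (hd x).differentiableAt) (fun x => (hd x).deriv) x 0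
  have hJ0 : J 0 = 0 := by simp [hJ, h0]
  exact this.trans hJ0

theorem eq_zero_iff_neg (E : CollinearTriples f f') (h0 : f 0 = 0)
    (h1 : ∀ x, HasDerivAt f (f' x) x) (h2 : ∀ x, HasDerivAt f' (f'' x) x) (ha : f' 0 ≠ 0)
    {x : ℝ} (hx : f (-x) = 0) : f x = 0 := by
  have := E.first_integral h0 h1 h2 (k := f'' 0 / f' 0) (by field_simp) x
  rw [hx] at this
  simpa [ha] using this

theorem exists_cubic_on (E : CollinearTriples f f') (h0 : f 0 = 0)
    (h1 : ∀ x, HasDerivAt f (f' x) x) (h2 : ∀ x, HasDerivAt f' (f'' x) x) (ha : f' 0 ≠ 0)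
    {k : ℝ} (hk : f'' 0 = k * f' 0) {s : Set ℝ} (hs : IsOpen s) (hs' : IsPreconnected s)
    (hne : ∀ x ∈ s, f x ≠ 0) :
    ∃ C : ℝ, ∀ x ∈ s, f' x ^ 2 = (f' 0 + k * f x) ^ 2 + C * f x ^ 3 ∧
      f' (-x) ^ 2 = (f' 0 + k * f (-x)) ^ 2 + C * f (-x) ^ 3 := by
  have hne' : ∀ x ∈ s, f (-x) ≠ 0 := fun x hx h =>
    hne x hx (E.eq_zero_iff_neg h0 h1 h2 ha h)
  set M : ℝ → ℝ := fun x => (f' x - f' 0 - k * f x) / (f x ^ 2 * f (-x)) with hM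
  have hd : ∀ x ∈ s, HasDerivAt M 0 x := by
    intro x hx
    have hu := hne x hx
    have hv := hne' x hx
    have hn : HasDerivAt (fun x => f (-x)) (f' (-x) * -1) x :=
      (h1 (-x)).comp x (hasDerivAt_neg x)
    have := (((h2 x).sub_const (f' 0)).sub ((h1 x).const_mul k)).div
      (((h1 x).pow 2).mul hn) (mul_ne_zero (pow_ne_zero 2 hu) hv)
    refine this.congr_deriv ?_
    have e1 := E.deriv_at_zero h0 h1 h2 (-x)
    have e0 := E.at_zero h0 x
    rw [neg_neg, hk] at e1
    rw [div_eq_zero_iff]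
    left
    simp only [Pi.pow_apply, Pi.mul_apply, Pi.sub_apply, Nat.cast_ofNat, Nat.add_one_sub_one,
      pow_one]
    linear_combination f x ^ 2 * e1 + f x * (2 * f' x - k * f x) * e0
  obtain ⟨m, hm⟩ : ∃ m, ∀ x ∈ s, M x = m :=
    hs.exists_is_const_of_deriv_eq_zero hs'
      (fun x hx => (hd x hx).differentiableAt.differentiableWithinAt)
      (fun x hx => (hd x hx).deriv)
  refine ⟨-2 * f' 0 * m, fun x hx => ?_⟩
  have hu := hne x hx
  have hv := hne' x hx
  have hw : f' x - f' 0 - k * f x = m * (f x ^ 2 * f (-x)) := by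
    rw [← hm x hx, hM]
    field_simp
  have e0 := E.at_zero h0 x
  have hJ := E.first_integral h0 h1 h2 hk x
  have hw' : f' (-x) - f' 0 - k * f (-x) = m * (f x * f (-x) ^ 2) := by
    apply mul_left_cancel₀ hu
    linear_combination e0 + f (-x) * hw
  constructor
  · apply mul_left_cancel₀ hv
    linear_combination (f' x - f' 0 - k * f x) * hJ - 2 * f' 0 * f x * hw
  · apply mul_left_cancel₀ hu
    have hJ' := E.first_integral h0 h1 h2 hk (-x)
    rw [neg_neg] at hJ'
    linear_combination (f' (-x) - f' 0 - k * f (-x)) * hJ' - 2 * f' 0 * f (-x) * hw'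

theorem pos_of_pos (E : CollinearTriples f f') (h0 : f 0 = 0)
    (h1 : ∀ x, HasDerivAt f (f' x) x) (h2 : ∀ x, HasDerivAt f' (f'' x) x) (ha : 0 < f' 0) :
    ∀ x, 0 < x → 0 < f x := by
  by_contra! hcon
  obtain ⟨x₀, hx₀, hfx₀⟩ := hcon
  have hc : Continuous f := continuous_iff_continuousAt.mpr fun x => (h1 x).continuousAt
  have hc' : Continuous f' := continuous_iff_continuousAt.mpr fun x => (h2 x).continuousAt
  obtain ⟨ε, hε, hpos⟩ := exists_mul_sub_pos_of_hasDerivAt (h1 0) ha h0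
  have hpos' : ∀ y, 0 < y → y < ε → 0 < f y := by
    intro y hy hyε
    have := hpos y (by rwa [sub_zero, abs_of_pos hy]) hy.ne'
    rw [sub_zero] at this
    exact pos_of_mul_pos_left this hy.le
  set Z : Set ℝ := {x | ε ≤ x ∧ f x ≤ 0} with hZ
  have hZc : IsClosed Z :=
    (isClosed_le continuous_const continuous_id).inter (isClosed_le hc continuous_const)
  have hZne : Z.Nonempty := ⟨x₀, by
    by_contra! h
    exact absurd (hpos' x₀ hx₀ h) hfx₀.not_gt, hfx₀⟩
  have hZb : BddBelow Z := ⟨ε, fun x hx => hx.1⟩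
  set X := sInf Z with hX
  obtain ⟨hXε, hfX⟩ : X ∈ Z := hZc.csInf_mem hZne hZb
  have hXpos : 0 < X := hε.trans_le hXε
  have hlt : ∀ x ∈ Set.Ioo 0 X, 0 < f x := by
    rintro x ⟨hx, hxX⟩
    by_contra! h
    rcases lt_or_ge x ε with hxε | hxε
    · exact absurd (hpos' x hx hxε) h.not_gt
    · exact absurd (csInf_le hZb (show x ∈ Z from ⟨hxε, h⟩)) hxX.not_ge
  have hXcl : X ∈ closure (Set.Ioo 0 X) := by
    rw [closure_Ioo hXpos.ne]
    exact ⟨hXpos.le, le_rfl⟩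
  have hfX0 : f X = 0 := le_antisymm hfX <|
    closure_minimal (fun x hx => (hlt x hx).le) (isClosed_le continuous_const hc) hXcl
  have hk : f'' 0 = f'' 0 / f' 0 * f' 0 := by field_simp
  obtain ⟨C, hC⟩ := E.exists_cubic_on h0 h1 h2 ha.ne' hk isOpen_Ioo isPreconnected_Ioo
    (fun x hx => (hlt x hx).ne')
  have hsq : f' X ^ 2 = (f' 0 + f'' 0 / f' 0 * f X) ^ 2 + C * f X ^ 3 :=
    closure_minimal (fun x hx => (hC x hx).1)
      (isClosed_eq (by fun_prop) (by fun_prop)) hXcl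
  have hfnX : f (-X) = 0 := E.eq_zero_iff_neg h0 h1 h2 ha.ne' (by rwa [neg_neg])
  have d1 := E.deriv_at_zero h0 h1 h2 X
  have d2 := E.deriv_at_zero h0 h1 h2 (-X)
  rw [neg_neg] at d2
  rw [hfX0] at hsq
  rw [hfX0, hfnX] at d1 d2
  have hpq : f' X = f' (-X) := by
    apply mul_left_cancel₀ ha.ne'
    linear_combination (d2 - d1) / 3
  rw [← hpq] at d1
  have hpa : f' X = f' 0 := by
    apply mul_left_cancel₀ ha.ne'
    linear_combination d1 + hsq
  obtain ⟨δ, hδ, hneg⟩ := exists_mul_sub_pos_of_hasDerivAt (h1 X) (hpa ▸ ha) hfX0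
  set y := max (X / 2) (X - δ / 2) with hy
  have hy1 : X / 2 ≤ y := le_max_left _ _
  have hy2 : X - δ / 2 ≤ y := le_max_right _ _
  have hy3 : y < X := max_lt (by linarith) (by linarith)
  have := hneg y (by rw [abs_of_neg (by linarith)]; linarith) hy3.ne
  nlinarith [hlt y ⟨by linarith, hy3⟩]

theorem exists_cubic_of_pos (E : CollinearTriples f f') (h0 : f 0 = 0)
    (h1 : ∀ x, HasDerivAt f (f' x) x) (h2 : ∀ x, HasDerivAt f' (f'' x) x) (ha : 0 < f' 0) :
    ∃ k C : ℝ, ∀ x, f' x ^ 2 = (f' 0 + k * f x) ^ 2 + C * f x ^ 3 := by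
  obtain ⟨C, hC⟩ := E.exists_cubic_on h0 h1 h2 ha.ne' (k := f'' 0 / f' 0) (by field_simp)
    isOpen_Ioi isPreconnected_Ioi (fun x hx => (E.pos_of_pos h0 h1 h2 ha x hx).ne')
  refine ⟨f'' 0 / f' 0, C, fun x => ?_⟩
  rcases lt_trichotomy x 0 with hx | rfl | hx
  · simpa using (hC (-x) (neg_pos.mpr hx)).2
  · simp [h0]
  · exact (hC x hx).1

theorem exists_cubic_of_ne_zero (E : CollinearTriples f f') (h0 : f 0 = 0)
    (h1 : ∀ x, HasDerivAt f (f' x) x) (h2 : ∀ x, HasDerivAt f' (f'' x) x) (ha : f' 0 ≠ 0) :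
    ∃ k C : ℝ, ∀ x, f' x ^ 2 = (f' 0 + k * f x) ^ 2 + C * f x ^ 3 := by
  rcases ha.lt_or_gt with ha | ha
  · obtain ⟨k, C, h⟩ := E.neg.exists_cubic_of_pos (by simp [h0]) (fun x => (h1 x).neg)
      (fun x => (h2 x).neg) (neg_pos.mpr ha)
    exact ⟨k, -C, fun x => by linear_combination h x⟩
  · exact E.exists_cubic_of_pos h0 h1 h2 ha

theorem mul_neg_eq_zero (E : CollinearTriples f f') (h0 : f 0 = 0)
    (h1 : ∀ x, HasDerivAt f (f' x) x) (ha : f' 0 = 0) (x : ℝ) : f x * f (-x) = 0 := by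
  have hd : ∀ x, HasDerivAt (fun x => f x * f (-x)) 0 x := by
    intro x
    have hn : HasDerivAt (fun x => f (-x)) (f' (-x) * -1) x :=
      (h1 (-x)).comp x (hasDerivAt_neg x)
    refine ((h1 x).mul hn).congr_deriv ?_
    have := E.at_zero h0 x
    rw [ha] at this
    linear_combination -this
  have := is_const_of_deriv_eq_zero (fun x => (hd x).differentiableAt) (fun x => (hd x).deriv) x 0
  simpa [h0] using this

theorem eq_zero_near_zero (E : CollinearTriples f f') (h0 : f 0 = 0)
    (h1 : ∀ x, HasDerivAt f (f' x) x) (ha : f' 0 = 0) :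
    ∃ η > 0, ∀ x ∈ Set.Ioo (-η) η, f x = 0 := by
  by_cases hz : ∀ x, f x = 0
  · exact ⟨1, one_pos, fun x _ => hz x⟩
  push Not at hz
  obtain ⟨x₀, hx₀⟩ := hz
  have hev : ∀ᶠ y in nhds (-x₀), f y = 0 := by
    have hc : ContinuousAt (fun y => f (-y)) (-x₀) :=
      ContinuousAt.comp (by rw [neg_neg]; exact (h1 x₀).continuousAt) continuousAt_neg
    filter_upwards [hc.eventually_ne (by simpa using hx₀)] with y hy
    exact (mul_eq_zero.mp (E.mul_neg_eq_zero h0 h1 ha y)).resolve_right hy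
  have hev' : ∀ᶠ y in nhds (-x₀), f y = 0 ∧ f' y = 0 := by
    filter_upwards [hev, hev.eventually_nhds] with y hy hy'
    refine ⟨hy, (h1 y).unique ?_⟩
    exact (hasDerivAt_const y (0 : ℝ)).congr_of_eventuallyEq hy'
  obtain ⟨ε, hε, h⟩ := Metric.eventually_nhds_iff.mp hev'
  refine ⟨ε, hε,
    eq_zero_of_deriv_eq_const_mul h1 (convex_Ioo _ _) (c := f' x₀ / f x₀) (t := 0) ?_ ?_ h0⟩
  · rintro z ⟨hz1, hz2⟩
    obtain ⟨k1, k2⟩ := h (y := -x₀ - z) (by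
      rw [Real.dist_eq, abs_lt]
      constructor <;> linarith)
    have := E x₀ z
    rw [k1, k2] at this
    field_simp
    linear_combination this
  · constructor <;> linarith

/-- If `f` vanishes on `(α, β)` and `f x ≠ 0`, the zero of `f` at `-x` spreads to
`(-x - β, -x - α)`. -/
theorem eq_zero_spread (E : CollinearTriples f f') (h0 : f 0 = 0)
    (h1 : ∀ x, HasDerivAt f (f' x) x) (ha : f' 0 = 0) {α β x : ℝ} (hα : α < 0) (hβ : 0 < β)
    (hz : ∀ z ∈ Set.Ioo α β, f z = 0) (hx : f x ≠ 0) :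
    ∀ y ∈ Set.Ioo (-x - β) (-x - α), f y = 0 := by
  refine eq_zero_of_deriv_eq_const_mul h1 (convex_Ioo _ _) (c := f' x / f x) (t := -x) ?_ ?_
    ((mul_eq_zero.mp (E.mul_neg_eq_zero h0 h1 ha x)).resolve_left hx)
  · rintro y ⟨hy1, hy2⟩
    have hmem : -x - y ∈ Set.Ioo α β := ⟨by linarith, by linarith⟩
    have hd : f' (-x - y) = 0 := by
      refine (h1 _).unique ((hasDerivAt_const _ (0 : ℝ)).congr_of_eventuallyEq ?_)
      filter_upwards [isOpen_Ioo.mem_nhds hmem] with z hz' using hz z hz'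
    have := E x y
    rw [hz _ hmem, hd] at this
    field_simp
    linear_combination this
  · constructor <;> linarith

theorem eq_zero_extend (E : CollinearTriples f f') (h0 : f 0 = 0)
    (h1 : ∀ x, HasDerivAt f (f' x) x) (ha : f' 0 = 0) {ξ x : ℝ}
    (hz : ∀ z ∈ Set.Ioo (-ξ) ξ, f z = 0) (hx : f x ≠ 0) (hξx : ξ < x) (hxξ : x < 2 * ξ) :
    ∀ y ∈ Set.Ioo 0 ((x + ξ) / 2), f y = 0 ∧ f (-y) = 0 := by
  have hz' : ∀ z ∈ Set.Ioo (-x - ξ) ξ, f z = 0 := by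
    rintro z ⟨hz1, hz2⟩
    rcases lt_or_ge (-ξ) z with h | h
    · exact hz z ⟨h, hz2⟩
    · exact E.eq_zero_spread h0 h1 ha (by linarith) (by linarith) hz hx z
        ⟨by linarith, by linarith⟩
  rintro y ⟨hy1, hy2⟩
  refine ⟨?_, hz' _ ⟨by linarith, by linarith⟩⟩
  by_contra hy
  exact hy (E.eq_zero_spread h0 h1 ha (by linarith) (by linarith) hz' hy y
    ⟨by linarith, by linarith⟩)

theorem eq_zero (E : CollinearTriples f f') (h0 : f 0 = 0)
    (h1 : ∀ x, HasDerivAt f (f' x) x) (ha : f' 0 = 0) : ∀ x, f x = 0 := by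
  obtain ⟨η, hη, hfη⟩ := E.eq_zero_near_zero h0 h1 ha
  have hc : Continuous f := continuous_iff_continuousAt.mpr fun x => (h1 x).continuousAt
  set V : Set ℝ := {x | 0 < x ∧ (f x ≠ 0 ∨ f (-x) ≠ 0)} with hV
  by_contra! hne
  have hVne : V.Nonempty := by
    obtain ⟨x, hx⟩ := hne
    rcases lt_trichotomy x 0 with h | rfl | h
    · exact ⟨-x, neg_pos.mpr h, Or.inr (by rwa [neg_neg])⟩
    · exact absurd h0 hx
    · exact ⟨x, h, Or.inl hx⟩
  have hVη : ∀ x ∈ V, η ≤ x := by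
    rintro x ⟨hx, hx'⟩
    by_contra! h
    rcases hx' with h' | h'
    · exact h' (hfη _ ⟨by linarith, h⟩)
    · exact h' (hfη _ ⟨by linarith, by linarith⟩)
  set ξ := sInf V with hξ
  have hξpos : 0 < ξ := hη.trans_le (le_csInf hVne hVη)
  have hz : ∀ z ∈ Set.Ioo (-ξ) ξ, f z = 0 := by
    rintro z ⟨hz1, hz2⟩
    by_contra h
    rcases lt_trichotomy z 0 with hz0 | rfl | hz0
    · have : ξ ≤ -z := csInf_le ⟨η, hVη⟩ ⟨neg_pos.mpr hz0, Or.inr (by rwa [neg_neg])⟩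
      linarith
    · exact h h0
    · have : ξ ≤ z := csInf_le ⟨η, hVη⟩ ⟨hz0, Or.inl h⟩
      linarith
  have hz' : ∀ z ∈ Set.Icc (-ξ) ξ, f z = 0 := by
    rw [← closure_Ioo (by linarith)]
    exact closure_minimal hz (isClosed_eq hc continuous_const)
  obtain ⟨x, ⟨hx0, hxV⟩, hxξ⟩ := exists_lt_of_csInf_lt hVne (show sInf V < 2 * ξ by linarith)
  have hξx : ξ < x := by
    by_contra! h
    rcases hxV with h' | h'
    · exact h' (hz' _ ⟨by linarith, h⟩)
    · exact h' (hz' _ ⟨by linarith, by linarith⟩)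
  have key : ∀ y ∈ Set.Ioo 0 ((x + ξ) / 2), f y = 0 ∧ f (-y) = 0 := by
    rcases hxV with h | h
    · exact E.eq_zero_extend h0 h1 ha hz h hξx hxξ
    · intro y hy
      have := E.comp_neg.eq_zero_extend (ξ := ξ) (x := x) (by simpa using h0)
        (fun x => by
          simpa [Function.comp_def] using (h1 (-x)).comp x (hasDerivAt_neg x))
        (by simpa using ha) (fun z hz'' => hz _ ⟨by linarith [hz''.2], by linarith [hz''.1]⟩)
        h hξx hxξ y hy
      rw [neg_neg] at this
      exact this.symm
  obtain ⟨y, ⟨hy0, hyV⟩, hyx⟩ :=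
    exists_lt_of_csInf_lt hVne (show sInf V < (x + ξ) / 2 by linarith)
  obtain ⟨k1, k2⟩ := key y ⟨hy0, hyx⟩
  exact hyV.elim (fun h => h k1) (fun h => h k2)

end CollinearTriples

theorem stmt_1 (f : ℝ → ℝ)
    (hf1 : Differentiable ℝ f) (hf2 : Differentiable ℝ (deriv f))
    (hf3 : Differentiable ℝ (deriv (deriv f)))
    (hfnc : ¬ ∃ c : ℝ, ∀ x, f x = c)
    (heq : ∀ x y z : ℝ, x + y + z = 0 →
      Matrix.det !![(1 : ℝ), 1, 1; f x, f y, f z; deriv f x, deriv f y, deriv f z] = 0) :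
    ∃ p₀ p₁ p₂ p₃ : ℝ,
      ∀ x : ℝ, (deriv f x) ^ 2 = p₃ * (f x) ^ 3 + p₂ * (f x) ^ 2 + p₁ * f x + p₀ := by
  have h1 : ∀ x, HasDerivAt (fun x => f x - f 0) (deriv f x) x := fun x =>
    (hf1 x).hasDerivAt.sub_const _
  have h2 : ∀ x, HasDerivAt (deriv f) (deriv (deriv f) x) x := fun x => (hf2 x).hasDerivAt
  have E : CollinearTriples (fun x => f x - f 0) (deriv f) := by
    intro x y
    have := heq x y (-x - y) (by ring)
    rw [Matrix.det_fin_three] at this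
    simp at this
    linear_combination this
  by_cases ha : deriv f 0 = 0
  · exact absurd ⟨f 0, fun x => sub_eq_zero.mp (E.eq_zero (sub_self _) h1 ha x)⟩ hfnc
  · obtain ⟨k, C, h⟩ := E.exists_cubic_of_ne_zero (sub_self _) h1 h2 ha
    refine ⟨(deriv f 0 - k * f 0) ^ 2 - C * f 0 ^ 3,
      2 * k * (deriv f 0 - k * f 0) + 3 * C * f 0 ^ 2, k ^ 2 - 3 * C * f 0, C, fun x => ?_⟩
    linear_combination h x
end

section
/- Let f, g : ℝ → ℝ be differentiable and let c be a real constant. Suppose that f, g and the constant function h ≡ c satisfy det [[1,1,1],[f(x),g(y),c],[f'(x),g'(y),0]] = 0 for all real x, y (equivalently, (f(x) − c)·g'(y) = f'(x)·(g(y) − c) for all x, y). Then either f is identically equal to c, or g is identically equal to c, or there exist a real constant δ and nonzero real constants a, b such that f(x) = c + a·exp(δx) and g(y) = c + b·exp(δy) for all x, y. -/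
theorem eq_add_mul_exp_of_deriv_eq {f : ℝ → ℝ} {c δ : ℝ} (hf : Differentiable ℝ f)
    (h : ∀ x, deriv f x = δ * (f x - c)) (x : ℝ) :
    f x = c + (f 0 - c) * Real.exp (δ * x) := by
  have hd : ∀ t, HasDerivAt (fun t => (f t - c) * Real.exp (-(δ * t))) 0 t := by
    intro t
    have h1 : HasDerivAt (fun t => f t - c) (δ * (f t - c)) t :=
      h t ▸ (hf t).hasDerivAt.sub_const c
    have h2 : HasDerivAt (fun t => Real.exp (-(δ * t))) (Real.exp (-(δ * t)) * -(δ * 1)) t :=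
      (((hasDerivAt_id t).const_mul δ).neg).exp
    exact (h1.mul h2).congr_deriv (by ring)
  have hconst := is_const_of_deriv_eq_zero (fun t => (hd t).differentiableAt)
    (fun t => (hd t).deriv) x 0
  simp only [mul_zero, neg_zero, Real.exp_zero, mul_one] at hconst
  rw [← hconst, mul_assoc, ← Real.exp_add, neg_add_cancel, Real.exp_zero]
  ring

theorem stmt_6 (f g : ℝ → ℝ) (c : ℝ)
    (hf : Differentiable ℝ f) (hg : Differentiable ℝ g)
    (heq : ∀ x y : ℝ,
      Matrix.det !![(1 : ℝ), 1, 1; f x, g y, c; deriv f x, deriv g y, 0] = 0) :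
    (∀ x, f x = c) ∨ (∀ y, g y = c) ∨
      ∃ (δ a b : ℝ), a ≠ 0 ∧ b ≠ 0 ∧
        (∀ x, f x = c + a * Real.exp (δ * x)) ∧
        (∀ y, g y = c + b * Real.exp (δ * y)) := by
  have key : ∀ x y, (f x - c) * deriv g y = deriv f x * (g y - c) := by
    intro x y
    have h := heq x y
    simp only [Matrix.det_fin_three, Matrix.of_apply, Matrix.cons_val] at h
    linarith
  by_cases hfc : ∀ x, f x = c
  · exact Or.inl hfc
  by_cases hgc : ∀ y, g y = c
  · exact Or.inr (Or.inl hgc)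
  push Not at hfc hgc
  obtain ⟨x₀, hx₀⟩ := hfc
  obtain ⟨y₀, hy₀⟩ := hgc
  have hx := sub_ne_zero.mpr hx₀
  have hy := sub_ne_zero.mpr hy₀
  have hf' : ∀ x, deriv f x = deriv g y₀ / (g y₀ - c) * (f x - c) := by
    intro x
    field_simp
    linarith [key x y₀]
  have hg' : ∀ y, deriv g y = deriv g y₀ / (g y₀ - c) * (g y - c) := by
    intro y
    apply mul_left_cancel₀ hx
    rw [key x₀ y, hf' x₀]
    ring
  have hfe := eq_add_mul_exp_of_deriv_eq hf hf'
  have hge := eq_add_mul_exp_of_deriv_eq hg hg'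
  refine Or.inr (Or.inr ⟨_, f 0 - c, g 0 - c, ?_, ?_, hfe, hge⟩)
  · intro h
    exact hx₀ (by simpa [h] using hfe x₀)
  · intro h
    exact hy₀ (by simpa [h] using hge y₀)
end

section
/- Let f, g : ℝ → ℝ be differentiable functions satisfying f(x)·g'(y) − f'(x)·g(y) = 0 for all real x, y. If neither f nor g is identically zero, then there exist a real constant δ and nonzero real constants c₁, c₂ such that f(x) = c₁·exp(δx) and g(y) = c₂·exp(δy) for all real x, y. -/
theorem eq_mul_exp_of_deriv_eq_mul {h : ℝ → ℝ} {δ : ℝ} (hh : Differentiable ℝ h)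
    (hd : ∀ x, deriv h x = δ * h x) (x : ℝ) : h x = h 0 * Real.exp (δ * x) := by
  have key : ∀ y, HasDerivAt (fun t => h t * Real.exp (-(δ * t))) 0 y := by
    intro y
    have h1 : HasDerivAt (fun t : ℝ => -(δ * t)) (-(δ * 1)) y :=
      ((hasDerivAt_id y).const_mul δ).neg
    refine ((hh y).hasDerivAt.mul h1.exp).congr_deriv ?_
    rw [hd y]
    ring
  have hc := is_const_of_deriv_eq_zero (fun y => (key y).differentiableAt)
    (fun y => (key y).deriv) x 0
  simp only [mul_zero, neg_zero, Real.exp_zero, mul_one] at hc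
  rw [← hc, mul_assoc, ← Real.exp_add, neg_add_cancel, Real.exp_zero, mul_one]

theorem stmt_7 (f g : ℝ → ℝ)
    (hf : Differentiable ℝ f) (hg : Differentiable ℝ g)
    (heq : ∀ x y : ℝ, f x * deriv g y - deriv f x * g y = 0)
    (hfne : ¬ ∀ x, f x = 0) (hgne : ¬ ∀ y, g y = 0) :
    ∃ (δ c₁ c₂ : ℝ), c₁ ≠ 0 ∧ c₂ ≠ 0 ∧
      (∀ x, f x = c₁ * Real.exp (δ * x)) ∧
      (∀ y, g y = c₂ * Real.exp (δ * y)) := by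
  obtain ⟨a, ha⟩ := not_forall.mp hfne
  obtain ⟨b, hb⟩ := not_forall.mp hgne
  have hfd : ∀ x, deriv f x = deriv g b / g b * f x := by
    intro x
    field_simp
    linarith [heq x b]
  have hgd : ∀ y, deriv g y = deriv g b / g b * g y := by
    intro y
    apply mul_left_cancel₀ ha
    rw [← sub_eq_zero, ← heq a y, hfd a]
    ring
  have hfe := eq_mul_exp_of_deriv_eq_mul hf hfd
  have hge := eq_mul_exp_of_deriv_eq_mul hg hgd
  refine ⟨deriv g b / g b, f 0, g 0, fun h0 => ha ?_, fun h0 => hb ?_, hfe, hge⟩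
  · rw [hfe a, h0, zero_mul]
  · rw [hge b, h0, zero_mul]
end

section
/- Let N ≥ 1 and let f, g, h : ℝ → ℝ be N-times differentiable functions satisfying det [[1,1,1],[f(x),g(y),h(z)],[f'(x),g'(y),h'(z)]] = 0 for all real x, y, z with x + y + z = 0. For 1 ≤ k ≤ N define aₖ(x,y) = g⁽ᵏ⁻¹⁾(y) + (−1)ᵏ f⁽ᵏ⁻¹⁾(x), bₖ(x,y) = g⁽ᵏ⁾(y) + (−1)ᵏ f⁽ᵏ⁾(x), and cₖ(x,y) = Σ_{j=0}^{k} C(k,j) (−1)ʲ f⁽ʲ⁾(x) g⁽ᵏ⁻ʲ⁾(y). Then for all real x, y and z = −x − y, and for all 1 ≤ k ≤ N: aₖ(x,y)·h'(z) − bₖ(x,y)·h(z) + cₖ(x,y) = 0. -/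
/-- `aₖ(x,y) = g⁽ᵏ⁻¹⁾(y) + (−1)ᵏ f⁽ᵏ⁻¹⁾(x)`, i.e. `∂^(k-1)(g(y) − f(x))`
with `∂ = ∂_y − ∂_x`. -/
noncomputable def aFun (f g : ℝ → ℝ) (k : ℕ) (x y : ℝ) : ℝ :=
  iteratedDeriv (k - 1) g y + (-1 : ℝ) ^ k * iteratedDeriv (k - 1) f x

/-- `bₖ(x,y) = g⁽ᵏ⁾(y) + (−1)ᵏ f⁽ᵏ⁾(x)`, i.e. `∂^k(g(y) + f(x))`. -/
noncomputable def bFun (f g : ℝ → ℝ) (k : ℕ) (x y : ℝ) : ℝ :=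
  iteratedDeriv k g y + (-1 : ℝ) ^ k * iteratedDeriv k f x

/-- `cₖ(x,y) = Σ_{j=0}^{k} C(k,j) (−1)ʲ f⁽ʲ⁾(x) g⁽ᵏ⁻ʲ⁾(y)`, i.e. `∂^k(g(y)·f(x))`. -/
noncomputable def cFun (f g : ℝ → ℝ) (k : ℕ) (x y : ℝ) : ℝ :=
  ∑ j ∈ Finset.range (k + 1),
    (k.choose j : ℝ) * (-1 : ℝ) ^ j * iteratedDeriv j f x * iteratedDeriv (k - j) g y

theorem cFun_succ (f g : ℝ → ℝ) (k : ℕ) (x y : ℝ) :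
    cFun f g (k + 1) x y = ∑ j ∈ Finset.range (k + 1), (k.choose j : ℝ) * (-1 : ℝ) ^ j *
      (-iteratedDeriv (j + 1) f x * iteratedDeriv (k - j) g y +
        iteratedDeriv j f x * iteratedDeriv (k - j + 1) g y) := by
  have key := Finset.sum_choose_succ_mul
    (fun i j ↦ (-1 : ℝ) ^ i * iteratedDeriv i f x * iteratedDeriv j g y) k
  simp only [← mul_assoc] at key
  rw [cFun, key, ← Finset.sum_add_distrib]
  refine Finset.sum_congr rfl fun j hj ↦ ?_
  rw [Nat.sub_add_comm (Nat.lt_succ_iff.mp (Finset.mem_range.mp hj))]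
  ring

theorem hasDerivAt_iteratedDeriv_const_add {g : ℝ → ℝ} {i : ℕ}
    (hg : Differentiable ℝ (iteratedDeriv i g)) (y t : ℝ) :
    HasDerivAt (fun t ↦ iteratedDeriv i g (y + t)) (iteratedDeriv (i + 1) g (y + t)) t := by
  rw [iteratedDeriv_succ]
  exact (hg _).hasDerivAt.comp_const_add y t

theorem hasDerivAt_iteratedDeriv_const_sub {f : ℝ → ℝ} {i : ℕ}
    (hf : Differentiable ℝ (iteratedDeriv i f)) (x t : ℝ) :
    HasDerivAt (fun t ↦ iteratedDeriv i f (x - t)) (-iteratedDeriv (i + 1) f (x - t)) t := by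
  rw [iteratedDeriv_succ]
  exact (hf _).hasDerivAt.comp_const_sub x t

theorem hasDerivAt_aFun {f g : ℝ → ℝ} {k : ℕ} (hk : 1 ≤ k)
    (hf : Differentiable ℝ (iteratedDeriv (k - 1) f))
    (hg : Differentiable ℝ (iteratedDeriv (k - 1) g)) (x y t : ℝ) :
    HasDerivAt (fun t ↦ aFun f g k (x - t) (y + t)) (aFun f g (k + 1) (x - t) (y + t)) t := by
  obtain ⟨k, rfl⟩ := Nat.exists_eq_add_of_le' hk
  refine ((hasDerivAt_iteratedDeriv_const_add hg y t).add
    ((hasDerivAt_iteratedDeriv_const_sub hf x t).const_mul ((-1) ^ (k + 1)))).congr_deriv ?_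
  simp only [aFun, Nat.add_sub_cancel]
  ring

theorem hasDerivAt_bFun {f g : ℝ → ℝ} {k : ℕ}
    (hf : Differentiable ℝ (iteratedDeriv k f))
    (hg : Differentiable ℝ (iteratedDeriv k g)) (x y t : ℝ) :
    HasDerivAt (fun t ↦ bFun f g k (x - t) (y + t)) (bFun f g (k + 1) (x - t) (y + t)) t := by
  refine ((hasDerivAt_iteratedDeriv_const_add hg y t).add
    ((hasDerivAt_iteratedDeriv_const_sub hf x t).const_mul ((-1) ^ k))).congr_deriv ?_
  simp only [bFun]
  ring

theorem hasDerivAt_cFun {f g : ℝ → ℝ} {k : ℕ}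
    (hf : ∀ i ≤ k, Differentiable ℝ (iteratedDeriv i f))
    (hg : ∀ i ≤ k, Differentiable ℝ (iteratedDeriv i g)) (x y t : ℝ) :
    HasDerivAt (fun t ↦ cFun f g k (x - t) (y + t)) (cFun f g (k + 1) (x - t) (y + t)) t := by
  rw [cFun_succ]
  refine HasDerivAt.fun_sum fun j hj ↦ ?_
  have hjk := Nat.lt_succ_iff.mp (Finset.mem_range.mp hj)
  simpa only [mul_assoc, Pi.mul_def] using
    ((hasDerivAt_iteratedDeriv_const_sub (hf j hjk) x t).mul
      (hasDerivAt_iteratedDeriv_const_add (hg (k - j) (Nat.sub_le k j)) y t)).const_mul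
        ((k.choose j : ℝ) * (-1) ^ j)

theorem stmt_8 (N : ℕ) (hN : 1 ≤ N) (f g h : ℝ → ℝ)
    (hf : ∀ i < N, Differentiable ℝ (iteratedDeriv i f))
    (hg : ∀ i < N, Differentiable ℝ (iteratedDeriv i g))
    (hh : ∀ i < N, Differentiable ℝ (iteratedDeriv i h))
    (heq : ∀ x y z : ℝ, x + y + z = 0 →
      Matrix.det !![(1 : ℝ), 1, 1; f x, g y, h z; deriv f x, deriv g y, deriv h z] = 0) :
    ∀ k : ℕ, 1 ≤ k → k ≤ N → ∀ x y : ℝ,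
      aFun f g k x y * deriv h (-x - y) - bFun f g k x y * h (-x - y)
        + cFun f g k x y = 0 := by
  intro k hk
  induction k, hk using Nat.le_induction with
  | base =>
    intro _ x y
    have hdet := heq x y (-x - y) (by ring)
    simp only [Matrix.det_fin_three, Matrix.of_apply, Matrix.cons_val] at hdet
    simp [aFun, bFun, cFun, Finset.sum_range_succ, iteratedDeriv_zero, iteratedDeriv_one]
    linarith
  | succ k hk ih =>
    intro hkN x y
    have hder := (((hasDerivAt_aFun hk (hf _ (by omega)) (hg _ (by omega)) x y 0).mul_const
      (deriv h (-x - y))).sub ((hasDerivAt_bFun (hf k hkN) (hg k hkN) x y 0).mul_const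
      (h (-x - y)))).add (hasDerivAt_cFun (fun i hi ↦ hf i (hi.trans_lt hkN))
      (fun i hi ↦ hg i (hi.trans_lt hkN)) x y 0)
    have hzero := hder.congr_of_eventuallyEq (f₁ := fun _ ↦ (0 : ℝ)) <| .of_forall fun t ↦ by
      have := ih (by omega) (x - t) (y + t)
      rw [show -(x - t) - (y + t) = -x - y by ring] at this
      exact this.symm
    simpa only [sub_zero, add_zero] using hzero.unique (hasDerivAt_const 0 0)
end

section
/- Let N ≥ 2, let 1 ≤ k, l ≤ N − 1, and let f, g, h : ℝ → ℝ be N-times differentiable functions satisfying det [[1,1,1],[f(x),g(y),h(z)],[f'(x),g'(y),h'(z)]] = 0 for all real x, y, z with x + y + z = 0. With aₖ(x,y) = g⁽ᵏ⁻¹⁾(y) + (−1)ᵏ f⁽ᵏ⁻¹⁾(x), bₖ(x,y) = g⁽ᵏ⁾(y) + (−1)ᵏ f⁽ᵏ⁾(x), cₖ(x,y) = Σ_{j=0}^{k} C(k,j) (−1)ʲ f⁽ʲ⁾(x) g⁽ᵏ⁻ʲ⁾(y), one has for all real x, y: det of the 3×3 matrix with columns (aₖ, bₖ, cₖ), (aₗ,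 bₗ, cₗ), and (aₖ·∂_y aₗ − aₗ·∂_y aₖ, aₖ·∂_y bₗ − aₗ·∂_y bₖ, aₖ·∂_y cₗ − aₗ·∂_y cₖ + bₖcₗ − bₗcₖ) equals 0, where ∂_y denotes partial differentiation with respect to y (so ∂_y aₗ = g⁽ˡ⁾(y), ∂_y bₗ = g⁽ˡ⁺¹⁾(y), ∂_y cₗ = Σ_{j=0}^{l} C(l,j) (−1)ʲ f⁽ʲ⁾(x) g⁽ˡ⁻ʲ⁺¹⁾(y)). -/
/-- `∂_y aₗ(x,y) = g⁽ˡ⁾(y)`. -/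
noncomputable def dyaFun (g : ℝ → ℝ) (l : ℕ) (y : ℝ) : ℝ := iteratedDeriv l g y

/-- `∂_y bₗ(x,y) = g⁽ˡ⁺¹⁾(y)`. -/
noncomputable def dybFun (g : ℝ → ℝ) (l : ℕ) (y : ℝ) : ℝ := iteratedDeriv (l + 1) g y

/-- `∂_y cₗ(x,y) = Σ_{j=0}^{l} C(l,j) (−1)ʲ f⁽ʲ⁾(x) g⁽ˡ⁻ʲ⁺¹⁾(y)`. -/
noncomputable def dycFun (f g : ℝ → ℝ) (l : ℕ) (x y : ℝ) : ℝ :=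
  ∑ j ∈ Finset.range (l + 1),
    (l.choose j : ℝ) * (-1 : ℝ) ^ j * iteratedDeriv j f x * iteratedDeriv (l - j + 1) g y

lemma hasDerivAt_iteratedDeriv {f : ℝ → ℝ} {i : ℕ} (hf : Differentiable ℝ (iteratedDeriv i f))
    (x : ℝ) : HasDerivAt (iteratedDeriv i f) (iteratedDeriv (i + 1) f x) x := by
  rw [iteratedDeriv_succ]
  exact (hf x).hasDerivAt

lemma hasDerivAt_iteratedDeriv_comp_sub {f : ℝ → ℝ} {i : ℕ}
    (hf : Differentiable ℝ (iteratedDeriv i f)) (x : ℝ) :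
    HasDerivAt (fun t => iteratedDeriv i f (x - t)) (-iteratedDeriv (i + 1) f x) 0 := by
  have h := hasDerivAt_iteratedDeriv hf (x - 0)
  simpa using h.comp_const_sub x 0

lemma hasDerivAt_iteratedDeriv_comp_add {f : ℝ → ℝ} {i : ℕ}
    (hf : Differentiable ℝ (iteratedDeriv i f)) (x : ℝ) :
    HasDerivAt (fun t => iteratedDeriv i f (x + t)) (iteratedDeriv (i + 1) f x) 0 := by
  have h := hasDerivAt_iteratedDeriv hf (x + 0)
  simpa using h.comp_const_add x 0

/-- `∂ cₖ = cₖ₊₁`, where `∂ = ∂_y − ∂_x` is realised as the derivative along `t ↦ (x - t, y + t)`. -/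
lemma hasDerivAt_cFun_sub_add {f g : ℝ → ℝ} {k : ℕ}
    (hf : ∀ i ≤ k, Differentiable ℝ (iteratedDeriv i f))
    (hg : ∀ i ≤ k, Differentiable ℝ (iteratedDeriv i g)) (x y : ℝ) :
    HasDerivAt (fun t => cFun f g k (x - t) (y + t)) (cFun f g (k + 1) x y) 0 := by
  have key : cFun f g (k + 1) x y = ∑ j ∈ Finset.range (k + 1),
      ((k.choose j : ℝ) * (-1 : ℝ) ^ j * (-iteratedDeriv (j + 1) f x) * iteratedDeriv (k - j) g y
        + (k.choose j : ℝ) * (-1 : ℝ) ^ j * iteratedDeriv j f x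
          * iteratedDeriv (k - j + 1) g y) := by
    have := Finset.sum_choose_succ_mul
      (fun i m => (-1 : ℝ) ^ i * iteratedDeriv i f x * iteratedDeriv m g y) k
    simp only [cFun, mul_assoc] at this ⊢
    rw [this, add_comm, Finset.sum_add_distrib]
    refine congrArg₂ _ (Finset.sum_congr rfl fun j _ => by ring) (Finset.sum_congr rfl fun j hj => ?_)
    rw [Nat.sub_add_comm (Nat.lt_succ_iff.mp (Finset.mem_range.mp hj))]
  rw [key]
  unfold cFun
  refine HasDerivAt.fun_sum fun j hj => ?_
  have h₁ := hasDerivAt_iteratedDeriv_comp_sub (hf j (by grind)) x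
  have h₂ := hasDerivAt_iteratedDeriv_comp_add (hg (k - j) (by grind)) y
  refine ((h₁.const_mul ((k.choose j : ℝ) * (-1 : ℝ) ^ j)).mul h₂).congr_deriv ?_
  simp only [add_zero, sub_zero]

/-- The functional equation, differentiated `k - 1` times along `x + y = const`. -/
lemma aFun_mul_deriv_sub_bFun_mul_add_cFun {f g h : ℝ → ℝ} {N : ℕ}
    (hf : ∀ i < N, Differentiable ℝ (iteratedDeriv i f))
    (hg : ∀ i < N, Differentiable ℝ (iteratedDeriv i g))
    (heq : ∀ x y z : ℝ, x + y + z = 0 →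
      Matrix.det !![(1 : ℝ), 1, 1; f x, g y, h z; deriv f x, deriv g y, deriv h z] = 0)
    {k : ℕ} (hk : 1 ≤ k) (hkN : k ≤ N) (x y : ℝ) :
    aFun f g k x y * deriv h (-x - y) - bFun f g k x y * h (-x - y) + cFun f g k x y = 0 := by
  induction k, hk using Nat.le_induction generalizing x y with
  | base =>
    have := heq x y (-x - y) (by ring)
    simp only [Matrix.det_fin_three, Matrix.of_apply, Matrix.cons_val] at this
    simp [aFun, bFun, cFun, Finset.sum_range_succ]
    linarith
  | succ k hk ih =>
    have ha : HasDerivAt (fun t => aFun f g k (x - t) (y + t)) (aFun f g (k + 1) x y) 0 := by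
      obtain ⟨m, rfl⟩ := Nat.exists_eq_add_of_le' hk
      refine ((hasDerivAt_iteratedDeriv_comp_add (hg m (by lia)) y).add
        ((hasDerivAt_iteratedDeriv_comp_sub (hf m (by lia)) x).const_mul ((-1) ^ (m + 1)))).congr_deriv
          ?_
      simp only [aFun, Nat.add_sub_cancel]
      ring
    have hb : HasDerivAt (fun t => bFun f g k (x - t) (y + t)) (bFun f g (k + 1) x y) 0 := by
      refine ((hasDerivAt_iteratedDeriv_comp_add (hg k (by lia)) y).add
        ((hasDerivAt_iteratedDeriv_comp_sub (hf k (by lia)) x).const_mul ((-1) ^ k))).congr_deriv ?_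
      simp only [bFun]
      ring
    have hc := hasDerivAt_cFun_sub_add (k := k) (fun i hi => hf i (by lia))
      (fun i hi => hg i (by lia)) x y
    refine (((ha.mul_const (deriv h (-x - y))).sub (hb.mul_const (h (-x - y)))).add hc).unique ?_
    refine (hasDerivAt_const (0 : ℝ) (0 : ℝ)).congr_of_eventuallyEq (.of_forall fun t => ?_)
    have := ih (by lia) (x - t) (y + t)
    rwa [show -(x - t) - (y + t) = -x - y by ring] at this

/-- The `y`-derivative of the relation between `aFun`, `bFun` and `cFun`. -/
lemma dyaFun_mul_deriv_sub_dybFun_mul_add_dycFun {f g h : ℝ → ℝ} {k : ℕ} (hk : 1 ≤ k)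
    (hg : ∀ i ≤ k, Differentiable ℝ (iteratedDeriv i g))
    (hh : Differentiable ℝ h) (hh' : Differentiable ℝ (deriv h))
    (hrel : ∀ x y, aFun f g k x y * deriv h (-x - y) - bFun f g k x y * h (-x - y)
      + cFun f g k x y = 0) (x y : ℝ) :
    dyaFun g k y * deriv h (-x - y) - aFun f g k x y * deriv (deriv h) (-x - y)
      - dybFun g k y * h (-x - y) + bFun f g k x y * deriv h (-x - y) + dycFun f g k x y = 0 := by
  have ha : HasDerivAt (fun t => aFun f g k x t) (dyaFun g k y) y := by
    obtain ⟨m, rfl⟩ := Nat.exists_eq_add_of_le' hk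
    exact (hasDerivAt_iteratedDeriv (hg m (by lia)) y).add_const _
  have hb : HasDerivAt (fun t => bFun f g k x t) (dybFun g k y) y :=
    (hasDerivAt_iteratedDeriv (hg k le_rfl) y).add_const _
  have hc : HasDerivAt (fun t => cFun f g k x t) (dycFun f g k x y) y := by
    refine HasDerivAt.fun_sum fun j _ => ?_
    exact (hasDerivAt_iteratedDeriv (hg (k - j) (by lia)) y).const_mul _
  have h₀ := (hh (-x - y)).hasDerivAt.comp_const_sub (-x) y
  have h₁ := (hh' (-x - y)).hasDerivAt.comp_const_sub (-x) y
  have hd := ((ha.mul h₁).sub (hb.mul h₀)).add hc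
  have h0 := hd.unique
    ((hasDerivAt_const y (0 : ℝ)).congr_of_eventuallyEq (.of_forall fun t => hrel x t))
  linarith

theorem stmt_11 (N : ℕ) (hN : 2 ≤ N) (k l : ℕ)
    (hk : 1 ≤ k) (hk' : k ≤ N - 1) (hl : 1 ≤ l) (hl' : l ≤ N - 1)
    (f g h : ℝ → ℝ)
    (hf : ∀ i < N, Differentiable ℝ (iteratedDeriv i f))
    (hg : ∀ i < N, Differentiable ℝ (iteratedDeriv i g))
    (hh : ∀ i < N, Differentiable ℝ (iteratedDeriv i h))
    (heq : ∀ x y z : ℝ, x + y + z = 0 →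
      Matrix.det !![(1 : ℝ), 1, 1; f x, g y, h z; deriv f x, deriv g y, deriv h z] = 0) :
    ∀ x y : ℝ,
      Matrix.det !![aFun f g k x y, aFun f g l x y,
                      aFun f g k x y * dyaFun g l y - aFun f g l x y * dyaFun g k y;
                    bFun f g k x y, bFun f g l x y,
                      aFun f g k x y * dybFun g l y - aFun f g l x y * dybFun g k y;
                    cFun f g k x y, cFun f g l x y,
                      aFun f g k x y * dycFun f g l x y - aFun f g l x y * dycFun f g k x y
                        + bFun f g k x y * cFun f g l x y
                        - bFun f g l x y * cFun f g k x y] = 0 := by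
  intro x y
  have hh₀ : Differentiable ℝ h := by simpa using hh 0 (by lia)
  have hh₁ : Differentiable ℝ (deriv h) := by simpa using hh 1 (by lia)
  have hrel := fun {m : ℕ} (hm : 1 ≤ m) (hmN : m ≤ N - 1) =>
    aFun_mul_deriv_sub_bFun_mul_add_cFun hf hg heq hm (by lia : m ≤ N)
  have hdrel := fun {m : ℕ} (hm : 1 ≤ m) (hmN : m ≤ N - 1) =>
    dyaFun_mul_deriv_sub_dybFun_mul_add_dycFun hm (fun i hi => hg i (by lia)) hh₀ hh₁
      (hrel hm hmN) x y
  have rk := hrel hk hk' x y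
  have rl := hrel hl hl' x y
  have dk := hdrel hk hk'
  have dl := hdrel hl hl'
  refine Matrix.exists_vecMul_eq_zero_iff.mp ⟨![deriv h (-x - y), -h (-x - y), 1], ?_, ?_⟩
  · exact fun h0 => one_ne_zero (congrFun h0 2)
  · ext i
    fin_cases i
    · simp [Matrix.vecMul, dotProduct, Fin.sum_univ_three]
      linear_combination rk
    · simp [Matrix.vecMul, dotProduct, Fin.sum_univ_three]
      linear_combination rl
    · simp [Matrix.vecMul, dotProduct, Fin.sum_univ_three]
      linear_combination aFun f g k x y * dl - aFun f g l x y * dk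
        - bFun f g l x y * rk + bFun f g k x y * rl
end

section
/- Let f, g, h : ℝ → ℝ be three-times differentiable, nonconstant functions satisfying det [[1,1,1],[f(x),g(y),h(z)],[f'(x),g'(y),h'(z)]] = 0 for all real x, y, z with x + y + z = 0. Then for all real x, y (writing f, f', f'', f''' for values at x and g, g', g'' for values at y): ( f'·g' − (g')² − f·g'' + g·g'' ) · ( 3(f')³ − 3f'·(g')² − 4f·f'·f'' + 4g·f'·f'' + g²·f''' − 2f·f'·g'' + 2g·f'·g'' + f²·f''' − 2f·g·f''' ) = 0. -/
/-- The derivative of an identically vanishing function is zero. -/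
theorem HasDerivAt.eq_zero_of_forall_eq_zero {φ : ℝ → ℝ} {φ' t : ℝ} (hφ : HasDerivAt φ φ' t)
    (h0 : ∀ s, φ s = 0) : φ' = 0 := by
  have : φ = fun _ => 0 := funext h0
  subst this
  exact hφ.unique (hasDerivAt_const t 0)

theorem stmt_12 (f g h : ℝ → ℝ)
    (hf1 : Differentiable ℝ f) (hf2 : Differentiable ℝ (deriv f))
    (hf3 : Differentiable ℝ (deriv (deriv f)))
    (hg1 : Differentiable ℝ g) (hg2 : Differentiable ℝ (deriv g))
    (hg3 : Differentiable ℝ (deriv (deriv g)))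
    (hh1 : Differentiable ℝ h) (hh2 : Differentiable ℝ (deriv h))
    (hh3 : Differentiable ℝ (deriv (deriv h)))
    (hfnc : ¬ ∃ c : ℝ, ∀ x, f x = c)
    (hgnc : ¬ ∃ c : ℝ, ∀ x, g x = c)
    (hhnc : ¬ ∃ c : ℝ, ∀ x, h x = c)
    (heq : ∀ x y z : ℝ, x + y + z = 0 →
      Matrix.det !![(1 : ℝ), 1, 1; f x, g y, h z; deriv f x, deriv g y, deriv h z] = 0) :
    ∀ x y : ℝ,
      (deriv f x * deriv g y - (deriv g y) ^ 2 - f x * deriv (deriv g) y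
          + g y * deriv (deriv g) y) *
        (3 * (deriv f x) ^ 3 - 3 * deriv f x * (deriv g y) ^ 2
          - 4 * f x * deriv f x * deriv (deriv f) x
          + 4 * g y * deriv f x * deriv (deriv f) x
          + (g y) ^ 2 * deriv (deriv (deriv f)) x
          - 2 * f x * deriv f x * deriv (deriv g) y
          + 2 * g y * deriv f x * deriv (deriv g) y
          + (f x) ^ 2 * deriv (deriv (deriv f)) x
          - 2 * f x * g y * deriv (deriv (deriv f)) x) = 0 := by
  have hE : ∀ x y z : ℝ, x + y + z = 0 →
      deriv h z * (g y - f x) + h z * (deriv f x - deriv g y)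
        + (f x * deriv g y - g y * deriv f x) = 0 := by
    intro x y z hxyz
    have := heq x y z hxyz
    simp only [Matrix.det_fin_three, Matrix.of_apply, Matrix.cons_val] at this
    linear_combination this
  have df1 (x : ℝ) : HasDerivAt f (deriv f x) x := (hf1 x).hasDerivAt
  have df2 (x : ℝ) : HasDerivAt (deriv f) (deriv (deriv f) x) x := (hf2 x).hasDerivAt
  have df3 (x : ℝ) : HasDerivAt (deriv (deriv f)) (deriv (deriv (deriv f)) x) x :=
    (hf3 x).hasDerivAt
  have dg1 (y : ℝ) : HasDerivAt g (deriv g y) y := (hg1 y).hasDerivAt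
  have dg2 (y : ℝ) : HasDerivAt (deriv g) (deriv (deriv g) y) y := (hg2 y).hasDerivAt
  -- Differentiate along `∂/∂x - ∂/∂y`, which leaves `z` fixed.
  have hW : ∀ x y z : ℝ, x + y + z = 0 →
      -deriv h z * (deriv f x + deriv g y) + h z * (deriv (deriv f) x + deriv (deriv g) y)
        + (2 * deriv f x * deriv g y - f x * deriv (deriv g) y
          - g y * deriv (deriv f) x) = 0 := by
    intro x y z hxyz
    have hy : y = -z - x := by linarith
    subst hy
    have hs : HasDerivAt (fun t : ℝ => -z - t) (-1) x := by
      simpa using (hasDerivAt_id x).const_sub (-z)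
    have G1 := (dg1 (-z - x)).comp x hs
    have G2 := (dg2 (-z - x)).comp x hs
    have key := ((((G1.sub (df1 x)).const_mul (deriv h z)).add
      (((df2 x).sub G2).const_mul (h z))).add
      (((df1 x).mul G2).sub (G1.mul (df2 x)))).eq_zero_of_forall_eq_zero
      (fun t => by simpa using hE t (-z - t) z (by ring))
    simp only [Function.comp_apply] at key
    linear_combination key
  -- Eliminate `h'` from the two relations.
  have hR : ∀ x y z : ℝ, x + y + z = 0 →
      (h z - f x) * ((g y - f x) * (deriv (deriv f) x + deriv (deriv g) y)
          + deriv f x * deriv f x - deriv g y * deriv g y)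
        - (g y - f x) * ((g y - f x) * deriv (deriv f) x + deriv f x * deriv f x
          - deriv f x * deriv g y) = 0 := by
    intro x y z hxyz
    linear_combination (g y - f x) * hW x y z hxyz + (deriv f x + deriv g y) * hE x y z hxyz
  intro x y
  obtain ⟨z, hxyz⟩ : ∃ z, x + y + z = 0 := ⟨-x - y, by ring⟩
  have e := hE x y z hxyz
  have r := hR x y z hxyz
  -- Differentiate the eliminated relation in `x`, with `y` fixed.
  have hRx : (-deriv h z - deriv f x) * ((g y - f x) * (deriv (deriv f) x + deriv (deriv g) y)
          + deriv f x ^ 2 - deriv g y ^ 2)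
        + (h z - f x) * (deriv f x * (deriv (deriv f) x - deriv (deriv g) y)
          + (g y - f x) * deriv (deriv (deriv f)) x)
        + deriv f x * ((g y - f x) * deriv (deriv f) x + deriv f x ^ 2 - deriv f x * deriv g y)
        - (g y - f x) * ((g y - f x) * deriv (deriv (deriv f)) x
          + deriv f x * deriv (deriv f) x - deriv (deriv f) x * deriv g y) = 0 := by
    have hz : z = -y - x := by linarith
    subst hz
    have hs : HasDerivAt (fun t : ℝ => -y - t) (-1) x := by
      simpa using (hasDerivAt_id x).const_sub (-y)
    have H := (hh1 (-y - x)).hasDerivAt.comp x hs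
    have A := (df1 x).const_sub (g y)
    have F := (df2 x).mul (df2 x)
    have key := (((H.sub (df1 x)).mul (((A.mul ((df3 x).add_const (deriv (deriv g) y))).add
        F).sub_const (deriv g y * deriv g y))).sub
      (A.mul (((A.mul (df3 x)).add F).sub
        ((df2 x).mul_const (deriv g y))))).eq_zero_of_forall_eq_zero
      (fun t => by simpa using hR t y (-y - t) (by ring))
    simp only [Function.comp_apply, Pi.mul_apply, Pi.add_apply, Pi.sub_apply] at key
    linear_combination key
  by_cases hA : g y - f x = 0
  · have w := hW x y z hxyz
    have hg : g y = f x := by linarith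
    rw [hg] at e w hRx ⊢
    have hB : (h z - f x) * (deriv f x - deriv g y) = 0 := by linear_combination e
    have hfg : deriv f x * deriv g y * (deriv f x - deriv g y) = 0 := by
      rcases mul_eq_zero.mp hB with hk | hB
      · have hh : h z = f x := by linarith
        rw [hh] at w hRx
        linear_combination (-1 / 3) * hRx + (1 / 3) * (deriv f x - deriv g y) * w
      · rw [hB, mul_zero]
    linear_combination 3 * (deriv f x - deriv g y) * (deriv f x + deriv g y) * hfg
  · refine (mul_eq_zero.mp ?_).resolve_left hA
    set P := (g y - f x) * (deriv (deriv f) x + deriv (deriv g) y)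
      + deriv f x ^ 2 - deriv g y ^ 2
    linear_combination (-1) * ((g y - f x) * P * hRx + P ^ 2 * e
      - ((g y - f x) * (deriv f x * (deriv (deriv f) x - deriv (deriv g) y)
          + (g y - f x) * deriv (deriv (deriv f)) x) + P * (deriv f x - deriv g y)) * r)
end

section
/- Let g : ℝ → ℝ be twice differentiable, let A, A', A'', A''' be real constants, and let y₀ be a point with A ≠ g(y₀) and g'(y₀) ≠ 0. Then 3(A')³ − 3A'·g'(y₀)² − 4A·A'·A'' + 4g(y₀)·A'·A'' + g(y₀)²·A''' − 2A·A'·g''(y₀) + 2g(y₀)·A'·g''(y₀) + A²·A''' − 2A·g(y₀)·A''' = ((A − g(y₀))⁴ / g'(y₀)) · D(y₀), where D is the derivative at y₀ of the function y ↦ A'·((A')² − g'(y)²)/(A − g(y))³ − 2A'·A''/(A − g(y))² + A'''/(A − g(y)). -/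
theorem stmt_14 (g : ℝ → ℝ)
    (hg1 : Differentiable ℝ g) (hg2 : Differentiable ℝ (deriv g))
    (A A' A'' A''' : ℝ) (y₀ : ℝ) (hA : A ≠ g y₀) (hg' : deriv g y₀ ≠ 0) :
    3 * A' ^ 3 - 3 * A' * (deriv g y₀) ^ 2 - 4 * A * A' * A'' + 4 * g y₀ * A' * A''
        + (g y₀) ^ 2 * A''' - 2 * A * A' * deriv (deriv g) y₀
        + 2 * g y₀ * A' * deriv (deriv g) y₀ + A ^ 2 * A''' - 2 * A * g y₀ * A'''
      = ((A - g y₀) ^ 4 / deriv g y₀) *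
          deriv (fun y =>
            A' * (A' ^ 2 - (deriv g y) ^ 2) / (A - g y) ^ 3
              - 2 * A' * A'' / (A - g y) ^ 2
              + A''' / (A - g y)) y₀ := by
  have hu : A - g y₀ ≠ 0 := sub_ne_zero.mpr hA
  have hdu : HasDerivAt (fun y => A - g y) (-deriv g y₀) y₀ :=
    (hg1 y₀).hasDerivAt.const_sub A
  have hnum : HasDerivAt (fun y => A' * (A' ^ 2 - (deriv g y) ^ 2))
      (A' * -(2 * deriv g y₀ * deriv (deriv g) y₀)) y₀ := by
    simpa using (((hg2 y₀).hasDerivAt.fun_pow 2).const_sub (A' ^ 2)).const_mul A'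
  have hD := ((hnum.fun_div (hdu.fun_pow 3) (pow_ne_zero 3 hu)).fun_sub
    ((hasDerivAt_const y₀ (2 * A' * A'')).fun_div (hdu.fun_pow 2) (pow_ne_zero 2 hu))).fun_add
    ((hasDerivAt_const y₀ A''').fun_div hdu hu)
  rw [hD.deriv]
  field_simp
  ring
end

section
/- Let f : ℝ → ℝ be a five-times differentiable function satisfying det [[1,1,1],[f(x),f(y),f(z)],[f'(x),f'(y),f'(z)]] = 0 for all real x, y, z with x + y + z = 0. Then for all real x (all derivatives evaluated at x): ( f'·f''' − (f'')² ) · ( (f')²·f⁽⁵⁾ − f'·(f''')² − 3f'·f''·f'''' + 3(f'')²·f''' ) = 0. -/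
/-- If the determinant with columns `(1, g₀, g₁)` at `a + h` and `a - h` and the fixed column
`(1, u, v)` vanishes for all `h`, then so do its Taylor coefficients at `h = 0` of orders one
and three. -/
theorem taylor_relations_of_det_eq_zero {g₀ g₁ g₂ g₃ g₄ : ℝ → ℝ}
    (h₀ : ∀ x, HasDerivAt g₀ (g₁ x) x) (h₁ : ∀ x, HasDerivAt g₁ (g₂ x) x)
    (h₂ : ∀ x, HasDerivAt g₂ (g₃ x) x) (h₃ : ∀ x, HasDerivAt g₃ (g₄ x) x) {a u v : ℝ}
    (hdet : ∀ h : ℝ, (g₀ (a - h) * v - u * g₁ (a - h)) - (g₀ (a + h) * v - u * g₁ (a + h))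
      + (g₀ (a + h) * g₁ (a - h) - g₀ (a - h) * g₁ (a + h)) = 0) :
    (u - g₀ a) * g₂ a = (v - g₁ a) * g₁ a ∧
      (u - g₀ a) * g₄ a - (v - g₁ a) * g₃ a = -3 * (g₁ a * g₃ a - g₂ a ^ 2) := by
  have shift_add {g g' : ℝ → ℝ} (hg : ∀ x, HasDerivAt g (g' x) x) (h : ℝ) :
      HasDerivAt (fun h ↦ g (a + h)) (g' (a + h)) h := (hg (a + h)).comp_const_add a h
  have shift_sub {g g' : ℝ → ℝ} (hg : ∀ x, HasDerivAt g (g' x) x) (h : ℝ) :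
      HasDerivAt (fun h ↦ g (a - h)) (-g' (a - h)) h := (hg (a - h)).comp_const_sub a h
  have deriv_zero {F : ℝ → ℝ} {d h : ℝ} (hF : ∀ h, F h = 0) (hd : HasDerivAt F d h) :
      d = 0 :=
    hd.unique ((hasDerivAt_const h 0).congr_of_eventuallyEq (Filter.Eventually.of_forall hF))
  have first (h : ℝ) : -g₁ (a - h) * v + u * g₂ (a - h) - g₁ (a + h) * v + u * g₂ (a + h)
      + (2 * (g₁ (a + h) * g₁ (a - h)) - g₀ (a + h) * g₂ (a - h)
        - g₀ (a - h) * g₂ (a + h)) = 0 := by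
    refine deriv_zero hdet (h := h) ?_
    refine HasDerivAt.congr_deriv
      (((((shift_sub h₀ h).mul_const v).sub
      ((shift_sub h₁ h).const_mul u)).sub
      (((shift_add h₀ h).mul_const v).sub ((shift_add h₁ h).const_mul u))).add
      (((shift_add h₀ h).mul (shift_sub h₁ h)).sub ((shift_sub h₀ h).mul (shift_add h₁ h)))) ?_
    ring
  have second (h : ℝ) : g₂ (a - h) * v - u * g₃ (a - h) - g₂ (a + h) * v + u * g₃ (a + h)
      + (3 * (g₂ (a + h) * g₁ (a - h)) - 3 * (g₁ (a + h) * g₂ (a - h))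
        + g₀ (a + h) * g₃ (a - h) - g₀ (a - h) * g₃ (a + h)) = 0 := by
    refine deriv_zero first (h := h) ?_
    refine HasDerivAt.congr_deriv
      ((((((shift_sub h₁ h).neg.mul_const v).add ((shift_sub h₂ h).const_mul u)).sub
      ((shift_add h₁ h).mul_const v)).add ((shift_add h₂ h).const_mul u)).add
      (((((shift_add h₁ h).mul (shift_sub h₁ h)).const_mul 2).sub
        ((shift_add h₀ h).mul (shift_sub h₂ h))).sub ((shift_sub h₀ h).mul (shift_add h₂ h)))) ?_
    ring
  have third (h : ℝ) : -g₃ (a - h) * v + u * g₄ (a - h) - g₃ (a + h) * v + u * g₄ (a + h)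
      + (4 * (g₃ (a + h) * g₁ (a - h)) - 6 * (g₂ (a + h) * g₂ (a - h))
        + 4 * (g₁ (a + h) * g₃ (a - h)) - g₀ (a + h) * g₄ (a - h)
        - g₀ (a - h) * g₄ (a + h)) = 0 := by
    refine deriv_zero second (h := h) ?_
    refine HasDerivAt.congr_deriv
      ((((((shift_sub h₂ h).mul_const v).sub ((shift_sub h₃ h).const_mul u)).sub
      ((shift_add h₂ h).mul_const v)).add ((shift_add h₃ h).const_mul u)).add
      ((((((shift_add h₂ h).mul (shift_sub h₁ h)).const_mul 3).sub
        (((shift_add h₁ h).mul (shift_sub h₂ h)).const_mul 3)).add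
        ((shift_add h₀ h).mul (shift_sub h₃ h))).sub ((shift_sub h₀ h).mul (shift_add h₃ h)))) ?_
    ring
  have e₁ := first 0
  have e₃ := third 0
  simp only [add_zero, sub_zero] at e₁ e₃
  constructor
  · linear_combination e₁ / 2
  · linear_combination e₃ / 2

theorem stmt_15 (f : ℝ → ℝ)
    (hf : ∀ i < 5, Differentiable ℝ (iteratedDeriv i f))
    (heq : ∀ x y z : ℝ, x + y + z = 0 →
      Matrix.det !![(1 : ℝ), 1, 1; f x, f y, f z; deriv f x, deriv f y, deriv f z] = 0) :
    ∀ x : ℝ,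
      (iteratedDeriv 1 f x * iteratedDeriv 3 f x - (iteratedDeriv 2 f x) ^ 2) *
        ((iteratedDeriv 1 f x) ^ 2 * iteratedDeriv 5 f x
          - iteratedDeriv 1 f x * (iteratedDeriv 3 f x) ^ 2
          - 3 * iteratedDeriv 1 f x * iteratedDeriv 2 f x * iteratedDeriv 4 f x
          + 3 * (iteratedDeriv 2 f x) ^ 2 * iteratedDeriv 3 f x) = 0 := by
  have hd (i : ℕ) (hi : i < 5) (x : ℝ) :
      HasDerivAt (iteratedDeriv i f) (iteratedDeriv (i + 1) f x) x := by
    rw [iteratedDeriv_succ]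
    exact (hf i hi x).hasDerivAt
  have h₀ (x : ℝ) : HasDerivAt f (iteratedDeriv 1 f x) x := by
    simpa using hd 0 (by norm_num) x
  have h₁ := hd 1 (by norm_num)
  have h₂ := hd 2 (by norm_num)
  have h₃ := hd 3 (by norm_num)
  have h₄ := hd 4 (by norm_num)
  have rel (a : ℝ) := taylor_relations_of_det_eq_zero h₀ h₁ h₂ h₃ (a := a) (u := f (-2 * a))
    (v := iteratedDeriv 1 f (-2 * a)) fun h ↦ by
      have hdet := heq (a + h) (a - h) (-2 * a) (by ring)
      rw [Matrix.det_fin_three] at hdet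
      simp only [iteratedDeriv_one]
      simp at hdet ⊢
      linear_combination hdet
  generalize iteratedDeriv 1 f = p₁ at *
  generalize iteratedDeriv 2 f = p₂ at *
  generalize iteratedDeriv 3 f = p₃ at *
  generalize iteratedDeriv 4 f = p₄ at *
  generalize iteratedDeriv 5 f = p₅ at *
  intro x
  have key (a : ℝ) : (f (-2 * a) - f a) * (p₁ a * p₄ a - p₂ a * p₃ a)
      + 3 * ((p₁ a * p₃ a - p₂ a * p₂ a) * p₁ a) = 0 := by
    linear_combination p₁ a * (rel a).2 - p₃ a * (rel a).1
  have hz : HasDerivAt (fun a ↦ f (-2 * a)) (p₁ (-2 * x) * (-2)) x := by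
    simpa [Function.comp_def] using (h₀ (-2 * x)).comp x ((hasDerivAt_id x).const_mul (-2))
  have hkey := ((hz.sub (h₀ x)).mul (((h₁ x).mul (h₄ x)).sub ((h₂ x).mul (h₃ x)))).add
    (((((h₁ x).mul (h₃ x)).sub ((h₂ x).mul (h₂ x))).mul (h₁ x)).const_mul 3)
  have hder := hkey.unique ((hasDerivAt_const x (0 : ℝ)).congr_of_eventuallyEq
    (Filter.Eventually.of_forall key))
  simp only [Pi.sub_apply, Pi.mul_apply] at hder
  obtain ⟨r₁, r₃⟩ := rel x
  have hW : (f (-2 * x) - f x) * (p₁ x * p₅ x - p₃ x ^ 2)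
      = -9 * (p₁ x * p₃ x - p₂ x ^ 2) * p₂ x := by
    linear_combination hder + 2 * (p₂ x * r₃ - p₄ x * r₁)
  linear_combination (1 / 3) * ((p₁ x * p₅ x - p₃ x ^ 2) * key x
    - (p₁ x * p₄ x - p₂ x * p₃ x) * hW)
end

section
/- Let F, G : ℝ → ℝ be three-times differentiable functions satisfying F(x)F(y) + F(y)F(z) + F(z)F(x) = G(x) + G(y) + G(z) for all real x, y, z with x + y + z = 0. Then the function f = F' satisfies det [[1,1,1],[f(x),f(y),f(z)],[f'(x),f'(y),f'(z)]] = 0 for all real x, y, z with x + y + z = 0. -/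
/-- Chain rule for the reflected translate `t ↦ u (c - t)`. -/
theorem hasDerivAt_comp_const_sub_of_differentiable {u : ℝ → ℝ} (hu : Differentiable ℝ u)
    (c t : ℝ) : HasDerivAt (fun s => u (c - s)) (-deriv u (c - t)) t := by
  simpa using (hu (c - t)).hasDerivAt.comp_const_sub c t

/-- The functional equation differentiated along the direction that fixes `z`. -/
theorem deriv_mul_sub_deriv_mul_eq {F G : ℝ → ℝ} (hF : Differentiable ℝ F)
    (hG : Differentiable ℝ G)
    (heq : ∀ x y z : ℝ, x + y + z = 0 →
      F x * F y + F y * F z + F z * F x = G x + G y + G z)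
    {x y z : ℝ} (h : x + y + z = 0) :
    deriv F x * (F y + F z) - deriv F y * (F x + F z) = deriv G x - deriv G y := by
  obtain rfl : y = -z - x := by linarith
  have hFx := (hF x).hasDerivAt
  have hFy := hasDerivAt_comp_const_sub_of_differentiable hF (-z) x
  have hL := ((hFx.mul hFy).add (hFy.mul_const (F z))).add (hFx.const_mul (F z))
  have hR := ((hG x).hasDerivAt.add
    (hasDerivAt_comp_const_sub_of_differentiable hG (-z) x)).add_const (G z)
  have key := hL.unique (hR.congr_of_eventuallyEq
    (Filter.Eventually.of_forall fun t => heq t (-z - t) z (by ring)))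
  linarith

/-- The functional equation differentiated twice, with the second derivative of `G`
evaluated at a single point. -/
theorem deriv_deriv_mul_sub_eq {F G : ℝ → ℝ} (hF : Differentiable ℝ F)
    (hF' : Differentiable ℝ (deriv F)) (hG : Differentiable ℝ G)
    (hG' : Differentiable ℝ (deriv G))
    (heq : ∀ x y z : ℝ, x + y + z = 0 →
      F x * F y + F y * F z + F z * F x = G x + G y + G z)
    {x y z : ℝ} (h : x + y + z = 0) :
    deriv (deriv F) x * (F y + F z) - deriv F x * (deriv F y + deriv F z)
      + deriv F y * deriv F z = deriv (deriv G) x := by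
  obtain rfl : z = -y - x := by linarith
  have hFz := hasDerivAt_comp_const_sub_of_differentiable hF (-y) x
  have hL := ((hF' x).hasDerivAt.mul (hFz.const_add (F y))).sub
    (((hF x).hasDerivAt.add hFz).const_mul (deriv F y))
  have hR := (hG' x).hasDerivAt.sub_const (deriv G y)
  have key := hL.unique (hR.congr_of_eventuallyEq
    (Filter.Eventually.of_forall fun t =>
      deriv_mul_sub_deriv_mul_eq hF hG heq (show t + y + (-y - t) = 0 by ring)))
  linarith

theorem stmt_16 (F G : ℝ → ℝ)
    (hF1 : Differentiable ℝ F) (hF2 : Differentiable ℝ (deriv F))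
    (hF3 : Differentiable ℝ (deriv (deriv F)))
    (hG1 : Differentiable ℝ G) (hG2 : Differentiable ℝ (deriv G))
    (hG3 : Differentiable ℝ (deriv (deriv G)))
    (heq : ∀ x y z : ℝ, x + y + z = 0 →
      F x * F y + F y * F z + F z * F x = G x + G y + G z) :
    ∀ x y z : ℝ, x + y + z = 0 →
      Matrix.det !![(1 : ℝ), 1, 1; deriv F x, deriv F y, deriv F z;
        deriv (deriv F) x, deriv (deriv F) y, deriv (deriv F) z] = 0 := by
  intro x y z h
  obtain rfl : z = -x - y := by linarith
  have hFy := (hF1 y).hasDerivAt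
  have hFz := hasDerivAt_comp_const_sub_of_differentiable hF1 (-x) y
  have hfy := (hF2 y).hasDerivAt
  have hfz := hasDerivAt_comp_const_sub_of_differentiable hF2 (-x) y
  have hL := (((hFy.add hFz).const_mul (deriv (deriv F) x)).sub
    ((hfy.add hfz).const_mul (deriv F x))).add (hfy.mul hfz)
  have key := hL.unique ((hasDerivAt_const y (deriv (deriv G) x)).congr_of_eventuallyEq
    (Filter.Eventually.of_forall fun t =>
      deriv_deriv_mul_sub_eq hF1 hF2 hG1 hG2 heq (show x + t + (-x - t) = 0 by ring)))
  simp only [Matrix.det_fin_three, Matrix.of_apply, Matrix.cons_val]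
  linarith
end
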